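/- arXiv:2008.00677 — 3 statements merged into one kernel-verified Lean document; each statement's English description precedes it below -/
import Mathlib

section
/- For every dimension n ≥ 1 there exists a constant c₀ > 0 (depending only on n) with the following property. Let λ > 0, let B = B(x₀, r) be a ball in ℝⁿ, and let u be a λ-eigenfunction on an open neighborhood of the closure of B. Suppose Ω ⊆ B is an open set which is c₀-narrow on scale 1/√λ and u = 0 on (∂Ω) ∩ B. Then sup_Ω |u| ≤ 3·sup_{(∂Ω) ∩ ∂B} |u| (where the supremum over the empty set is taken to be 0). -/
open MeasureTheory Metric Set

/-- The Euclidean Laplacian `Δu = ∑ⱼ ∂²u/∂xⱼ²` of `u : ℝⁿ → ℝ`. -/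
noncomputable def lapl (n : ℕ) (u : EuclideanSpace ℝ (Fin n) → ℝ)
    (x : EuclideanSpace ℝ (Fin n)) : ℝ :=
  ∑ j : Fin n,
    fderiv ℝ (fun y => fderiv ℝ u y (EuclideanSpace.single j (1:ℝ))) x
      (EuclideanSpace.single j (1:ℝ))

/-- `Ω` is `c₀`-narrow on scale `s`: every ball of radius `s` centered at a point of the
closure of `Ω` meets `Ω` in measure at most `c₀` times the measure of the ball. -/
def IsNarrow (n : ℕ) (c₀ s : ℝ) (Ω : Set (EuclideanSpace ℝ (Fin n))) : Prop :=
  ∀ y ∈ closure Ω,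
    (volume (Ω ∩ ball y s)).toReal ≤ c₀ * (volume (ball y s)).toReal

open Filter Topology

theorem hasDerivAt_max_zero_pow (k : ℕ) (t : ℝ) :
    HasDerivAt (fun t : ℝ => max t 0 ^ (k + 2)) ((k + 2 : ℝ) * max t 0 ^ (k + 1)) t := by
  rcases lt_trichotomy t 0 with ht | rfl | ht
  · have : (fun t : ℝ => max t 0 ^ (k + 2)) =ᶠ[𝓝 t] fun _ => (0 : ℝ) := by
      filter_upwards [Iio_mem_nhds ht] with s hs
      simp [max_eq_right (le_of_lt (mem_Iio.1 hs))]
    simpa [max_eq_right ht.le] using (hasDerivAt_const t (0 : ℝ)).congr_of_eventuallyEq this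
  · rw [hasDerivAt_iff_tendsto_slope]
    have h : Tendsto (fun s : ℝ => max s 0 ^ (k + 1)) (𝓝[≠] 0) (𝓝 0) := by
      have : Continuous fun s : ℝ => max s 0 ^ (k + 1) := by fun_prop
      simpa using (this.tendsto 0).mono_left nhdsWithin_le_nhds
    simp only [max_self, ne_eq, Nat.add_eq_zero_iff, one_ne_zero, and_false, not_false_eq_true,
      zero_pow, mul_zero]
    refine h.congr' ?_
    filter_upwards [self_mem_nhdsWithin] with s hs
    rcases lt_or_gt_of_ne (show s ≠ 0 from hs) with hs | hs
    · simp [slope_def_field, max_eq_right hs.le]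
    · simp only [slope_def_field, max_eq_left hs.le]
      field_simp
      simp [pow_succ]
  · have : (fun t : ℝ => max t 0 ^ (k + 2)) =ᶠ[𝓝 t] fun t => t ^ (k + 2) := by
      filter_upwards [Ioi_mem_nhds ht] with s hs
      simp [max_eq_left (le_of_lt (mem_Ioi.1 hs))]
    simpa [max_eq_left ht.le] using (hasDerivAt_pow (k + 2) t).congr_of_eventuallyEq this

theorem contDiff_two_max_zero_pow_three : ContDiff ℝ 2 (fun t : ℝ => max t 0 ^ 3) := by
  have hd : deriv (fun t : ℝ => max t 0 ^ 3) = fun t => 3 * max t 0 ^ 2 := by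
    ext t
    simpa [show (1 : ℝ) + 2 = 3 by norm_num] using (hasDerivAt_max_zero_pow 1 t).deriv
  have hd2 : deriv (fun t : ℝ => 3 * max t 0 ^ 2) = fun t => 3 * (2 * max t 0) := by
    ext t
    simpa using ((hasDerivAt_max_zero_pow 0 t).const_mul 3).deriv
  rw [show (2 : WithTop ℕ∞) = 1 + 1 by norm_num, contDiff_succ_iff_deriv]
  refine ⟨fun t => (hasDerivAt_max_zero_pow 1 t).differentiableAt, by simp, ?_⟩
  rw [hd, contDiff_one_iff_deriv, hd2]
  exact ⟨fun t => ((hasDerivAt_max_zero_pow 0 t).const_mul 3).differentiableAt, by fun_prop⟩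

theorem lapl_comp {n : ℕ} {u : EuclideanSpace ℝ (Fin n) → ℝ} (hu : ContDiff ℝ 2 u)
    {f p q : ℝ → ℝ} (hf : ∀ t, HasDerivAt f (p t) t) (hp : ∀ t, HasDerivAt p (q t) t)
    (x : EuclideanSpace ℝ (Fin n)) :
    lapl n (fun y => f (u y)) x =
      q (u x) * ∑ j, fderiv ℝ u x (EuclideanSpace.single j 1) ^ 2 + p (u x) * lapl n u x := by
  have hud : Differentiable ℝ u := hu.differentiable (by norm_num)
  have h1 : ∀ y, fderiv ℝ (fun y => f (u y)) y = p (u y) • fderiv ℝ u y := fun y =>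
    ((hf (u y)).comp_hasFDerivAt y (hud y).hasFDerivAt).fderiv
  have hdu : Differentiable ℝ (fderiv ℝ u) :=
    (hu.fderiv_right (m := 1) (by norm_num)).differentiable (by norm_num)
  simp only [lapl, h1, Finset.mul_sum, ← Finset.sum_add_distrib]
  refine Finset.sum_congr rfl fun j _ => ?_
  have h2 : DifferentiableAt ℝ (fun y => fderiv ℝ u y (EuclideanSpace.single j (1 : ℝ))) x :=
    (hdu x).clm_apply (differentiableAt_const _)
  have h3 := (((hp (u x)).comp_hasFDerivAt x (hud x).hasFDerivAt).mul h2.hasFDerivAt).fderiv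
  simp only [smul_apply, smul_eq_mul]
  erw [h3]
  simp
  ring

/-- The radial weight `4 (1 - |z|²)₊`, for which `∇ bumpPotential z = -bumpWeight z • z`. -/
noncomputable def bumpWeight (n : ℕ) (z : EuclideanSpace ℝ (Fin n)) : ℝ :=
  4 * max (1 - ‖z‖ ^ 2) 0

/-- The `C¹` bump function `((1 - |z|²)₊)²`. -/
noncomputable def bumpPotential (n : ℕ) (z : EuclideanSpace ℝ (Fin n)) : ℝ :=
  max (1 - ‖z‖ ^ 2) 0 ^ 2

variable {n : ℕ}

theorem continuous_bumpWeight : Continuous (bumpWeight n) := by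
  unfold bumpWeight; fun_prop

theorem continuous_bumpPotential : Continuous (bumpPotential n) := by
  unfold bumpPotential; fun_prop

theorem bumpWeight_nonneg (z : EuclideanSpace ℝ (Fin n)) : 0 ≤ bumpWeight n z :=
  mul_nonneg (by norm_num) (le_max_right _ _)

theorem bumpWeight_le (z : EuclideanSpace ℝ (Fin n)) : bumpWeight n z ≤ 4 := by
  have : max (1 - ‖z‖ ^ 2) 0 ≤ 1 := max_le (by nlinarith [sq_nonneg ‖z‖]) (by norm_num)
  unfold bumpWeight
  linarith

theorem bumpPotential_nonneg (z : EuclideanSpace ℝ (Fin n)) : 0 ≤ bumpPotential n z :=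
  sq_nonneg _

theorem bumpPotential_le (z : EuclideanSpace ℝ (Fin n)) :
    bumpPotential n z ≤ bumpWeight n z / 4 := by
  have h0 : 0 ≤ max (1 - ‖z‖ ^ 2) 0 := le_max_right _ _
  have h1 : max (1 - ‖z‖ ^ 2) 0 ≤ 1 := max_le (by nlinarith [sq_nonneg ‖z‖]) (by norm_num)
  unfold bumpWeight bumpPotential
  nlinarith

theorem max_one_sub_norm_sq_eq_zero {z : EuclideanSpace ℝ (Fin n)} (hz : 1 ≤ ‖z‖) :
    max (1 - ‖z‖ ^ 2) 0 = 0 :=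
  max_eq_right (by nlinarith)

theorem bumpWeight_eq_zero {z : EuclideanSpace ℝ (Fin n)} (hz : z ∉ ball 0 1) :
    bumpWeight n z = 0 := by
  rw [bumpWeight, max_one_sub_norm_sq_eq_zero (by simpa using hz), mul_zero]

theorem hasCompactSupport_bumpWeight : HasCompactSupport (bumpWeight n) :=
  HasCompactSupport.intro (isCompact_closedBall 0 1) fun _ hz =>
    bumpWeight_eq_zero fun h => hz (ball_subset_closedBall h)

theorem hasCompactSupport_bumpPotential : HasCompactSupport (bumpPotential n) :=
  HasCompactSupport.intro (isCompact_closedBall 0 1) fun z hz => by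
    rw [bumpPotential, max_one_sub_norm_sq_eq_zero
      (by simpa using fun h => hz (ball_subset_closedBall h))]
    norm_num

theorem integrable_bumpWeight : Integrable (bumpWeight n) :=
  continuous_bumpWeight.integrable_of_hasCompactSupport hasCompactSupport_bumpWeight

theorem integrable_bumpPotential : Integrable (bumpPotential n) :=
  continuous_bumpPotential.integrable_of_hasCompactSupport hasCompactSupport_bumpPotential

theorem integral_bumpWeight_pos : 0 < ∫ z, bumpWeight n z := by
  refine continuous_bumpWeight.integral_pos_of_hasCompactSupport_nonneg_nonzero
    hasCompactSupport_bumpWeight bumpWeight_nonneg (x := 0) ?_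
  simp [bumpWeight]

theorem hasFDerivAt_bumpPotential (z : EuclideanSpace ℝ (Fin n)) :
    HasFDerivAt (bumpPotential n) (-(bumpWeight n z • innerSL ℝ z)) z := by
  have h1 : HasFDerivAt (fun z : EuclideanSpace ℝ (Fin n) => 1 - ‖z‖ ^ 2)
      (-(2 • innerSL ℝ z)) z := (hasStrictFDerivAt_norm_sq z).hasFDerivAt.const_sub 1
  have h2 := (hasDerivAt_max_zero_pow 0 (1 - ‖z‖ ^ 2)).comp_hasFDerivAt z h1
  refine h2.congr_fderiv ?_
  ext w
  simp [bumpWeight]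
  ring

theorem integral_bumpWeight_mul_coord (g : EuclideanSpace ℝ (Fin n) → ℝ) (hg : ContDiff ℝ 1 g)
    (j : Fin n) :
    ∫ z, bumpWeight n z * (z j * g z) =
      ∫ z, bumpPotential n z * fderiv ℝ g z (EuclideanSpace.single j 1) := by
  have hf : ∀ z, fderiv ℝ (bumpPotential n) z (EuclideanSpace.single j 1) =
      -(bumpWeight n z * z j) := fun z => by
    simp [(hasFDerivAt_bumpPotential z).fderiv, EuclideanSpace.inner_single_right]
  have hgc := hg.continuous
  have hg' : Continuous fun z => fderiv ℝ g z (EuclideanSpace.single j 1) :=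
    (hg.continuous_fderiv (by norm_num)).clm_apply continuous_const
  have hw : Integrable fun z => bumpWeight n z * (z j * g z) :=
    (continuous_bumpWeight.mul (by fun_prop)).integrable_of_hasCompactSupport
      hasCompactSupport_bumpWeight.mul_right
  rw [integral_mul_fderiv_eq_neg_fderiv_mul_of_integrable]
  · simp only [hf, neg_mul, integral_neg, neg_neg, mul_assoc]
  · simpa only [hf, neg_mul, mul_assoc] using hw.fun_neg
  · exact (continuous_bumpPotential.mul hg').integrable_of_hasCompactSupport
      hasCompactSupport_bumpPotential.mul_right
  · exact (continuous_bumpPotential.mul hgc).integrable_of_hasCompactSupport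
      hasCompactSupport_bumpPotential.mul_right
  · exact fun z _ => (hasFDerivAt_bumpPotential z).differentiableAt
  · exact fun z _ => hg.differentiable (by norm_num) z

/-- The derivative in the scale `s` of the weighted mean of `v` over `B(y, s)`. -/
theorem hasDerivAt_integral_bumpWeight {v : EuclideanSpace ℝ (Fin n) → ℝ} (hv : ContDiff ℝ 2 v)
    (hvc : HasCompactSupport v) (y : EuclideanSpace ℝ (Fin n)) (s : ℝ) :
    HasDerivAt (fun s : ℝ => ∫ z, bumpWeight n z * v (y + s • z))
      (s * ∫ z, bumpPotential n z * lapl n v (y + s • z)) s := by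
  have hvd : Differentiable ℝ v := hv.differentiable (by norm_num)
  have hdv : ContDiff ℝ 1 (fderiv ℝ v) := hv.fderiv_right (by norm_num)
  have hdvc : Continuous (fderiv ℝ v) := hdv.continuous
  have hvcont : Continuous v := hv.continuous
  obtain ⟨C, hC⟩ := (hvc.fderiv ℝ).exists_bound_of_continuous hdvc
  have hbw := continuous_bumpWeight (n := n)
  have key := hasDerivAt_integral_of_dominated_loc_of_deriv_le (μ := volume) (𝕜 := ℝ) (s := univ)
    (x₀ := s) (F := fun s z => bumpWeight n z * v (y + s • z))
    (F' := fun s z => bumpWeight n z * fderiv ℝ v (y + s • z) z)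
    (bound := fun z => bumpWeight n z * (C * ‖z‖)) univ_mem
    (Eventually.of_forall fun t => Continuous.aestronglyMeasurable (by fun_prop))
    ((hbw.mul (by fun_prop)).integrable_of_hasCompactSupport
      hasCompactSupport_bumpWeight.mul_right)
    (Continuous.aestronglyMeasurable (by fun_prop))
    (Eventually.of_forall fun z t _ => by
      rw [norm_mul, Real.norm_of_nonneg (bumpWeight_nonneg z)]
      exact mul_le_mul_of_nonneg_left ((ContinuousLinearMap.le_opNorm _ _).trans
        (mul_le_mul_of_nonneg_right (hC _) (norm_nonneg _))) (bumpWeight_nonneg z))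
    ((hbw.mul (by fun_prop)).integrable_of_hasCompactSupport
      hasCompactSupport_bumpWeight.mul_right)
    (Eventually.of_forall fun z t _ => by
      have h1 : HasDerivAt (fun t : ℝ => y + t • z) z t := by
        simpa using ((hasDerivAt_id t).smul_const z).const_add y
      exact ((hvd _).hasFDerivAt.comp_hasDerivAt t h1).const_mul _)
  refine key.2.congr_deriv ?_
  let g : Fin n → EuclideanSpace ℝ (Fin n) → ℝ := fun j x =>
    fderiv ℝ v x (EuclideanSpace.single j 1)
  have hg : ∀ j, ContDiff ℝ 1 (g j) := fun j => hdv.clm_apply contDiff_const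
  have hgs : ∀ j, ContDiff ℝ 1 fun z : EuclideanSpace ℝ (Fin n) => g j (y + s • z) := fun j =>
    (hg j).comp (contDiff_const.add (contDiff_id.const_smul s))
  have hexp : ∀ z, fderiv ℝ v (y + s • z) z = ∑ j, z j * g j (y + s • z) := fun z => by
    conv_lhs => arg 2; rw [← (EuclideanSpace.basisFun (Fin n) ℝ).sum_repr z]
    simp [g]
  have hder : ∀ j z, fderiv ℝ (fun z => g j (y + s • z)) z (EuclideanSpace.single j 1) =
      s * fderiv ℝ (g j) (y + s • z) (EuclideanSpace.single j 1) := fun j z => by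
    have h1 : HasFDerivAt (fun z : EuclideanSpace ℝ (Fin n) => y + s • z)
        (s • ContinuousLinearMap.id ℝ _) z := ((hasFDerivAt_id z).const_smul s).const_add y
    have h2 := (((hg j).differentiable (by norm_num) (y + s • z)).hasFDerivAt.comp z h1).fderiv
    simp only [Function.comp_def] at h2
    simp [h2]
  have hint : ∀ j, Integrable fun z => bumpWeight n z * (z j * g j (y + s • z)) := fun j => by
    have := (hgs j).continuous
    exact (hbw.mul (by fun_prop)).integrable_of_hasCompactSupport
      hasCompactSupport_bumpWeight.mul_right
  have hint' : ∀ j, Integrable fun z => bumpPotential n z *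
      (s * fderiv ℝ (g j) (y + s • z) (EuclideanSpace.single j 1)) := fun j => by
    have h1 : Continuous (fderiv ℝ (g j)) := (hg j).continuous_fderiv (by norm_num)
    exact (continuous_bumpPotential.mul (by fun_prop)).integrable_of_hasCompactSupport
      hasCompactSupport_bumpPotential.mul_right
  calc ∫ z, bumpWeight n z * fderiv ℝ v (y + s • z) z
      = ∑ j, ∫ z, bumpWeight n z * (z j * g j (y + s • z)) := by
        rw [← integral_finsetSum _ fun j _ => hint j]
        simp only [hexp, Finset.mul_sum]
    _ = ∑ j, ∫ z, bumpPotential n z *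
          (s * fderiv ℝ (g j) (y + s • z) (EuclideanSpace.single j 1)) :=
        Finset.sum_congr rfl fun j _ => by
          rw [integral_bumpWeight_mul_coord _ (hgs j)]
          simp only [hder]
    _ = s * ∫ z, bumpPotential n z * lapl n v (y + s • z) := by
        rw [← integral_finsetSum _ fun j _ => hint' j, ← integral_const_mul]
        refine integral_congr_ae (Eventually.of_forall fun z => ?_)
        simp only [lapl, Finset.mul_sum, g]
        exact Finset.sum_congr rfl fun j _ => by ring

theorem continuous_lapl {v : EuclideanSpace ℝ (Fin n) → ℝ} (hv : ContDiff ℝ 2 v) :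
    Continuous (lapl n v) := by
  have hdv : ContDiff ℝ 1 (fderiv ℝ v) := hv.fderiv_right (by norm_num)
  refine continuous_finsetSum _ fun j _ => ?_
  have : ContDiff ℝ 1 fun x => fderiv ℝ v x (EuclideanSpace.single j (1 : ℝ)) :=
    hdv.clm_apply contDiff_const
  exact (this.continuous_fderiv (by norm_num)).clm_apply continuous_const

/-- A weighted mean value inequality for functions with Laplacian bounded below. -/
theorem mul_integral_bumpWeight_le {v : EuclideanSpace ℝ (Fin n) → ℝ} (hv : ContDiff ℝ 2 v)
    (hvc : HasCompactSupport v) {K : ℝ} (hK : 0 ≤ K) (hvK : ∀ x, -K ≤ lapl n v x)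
    (y : EuclideanSpace ℝ (Fin n)) {ρ : ℝ} (hρ : 0 ≤ ρ) :
    v y * ∫ z, bumpWeight n z ≤
      (∫ z, bumpWeight n z * v (y + ρ • z)) + K * ρ ^ 2 / 8 * ∫ z, bumpWeight n z := by
  set J := ∫ z, bumpPotential n z
  have hJ : J ≤ (∫ z, bumpWeight n z) / 4 := by
    rw [← integral_div]
    exact integral_mono integrable_bumpPotential (integrable_bumpWeight.div_const 4)
      bumpPotential_le
  have hd : ∀ s, HasDerivAt
      (fun s : ℝ => (∫ z, bumpWeight n z * v (y + s • z)) + K * J / 2 * s ^ 2)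
      (s * (∫ z, bumpPotential n z * lapl n v (y + s • z)) + K * J / 2 * (2 * s)) s := fun s => by
    simpa using (hasDerivAt_integral_bumpWeight hv hvc y s).fun_add
      ((hasDerivAt_pow 2 s).const_mul (K * J / 2))
  have hmono := monotoneOn_of_deriv_nonneg (convex_Ici (0 : ℝ))
    (fun s _ => (hd s).continuousAt.continuousWithinAt)
    (fun s _ => (hd s).differentiableAt.differentiableWithinAt) (fun s hs => by
      rw [(hd s).deriv]
      rw [interior_Ici, mem_Ioi] at hs
      have h1 : -K * J ≤ ∫ z, bumpPotential n z * lapl n v (y + s • z) := by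
        rw [mul_comm, ← integral_mul_const]
        have hl := continuous_lapl hv
        refine integral_mono (integrable_bumpPotential.mul_const _)
          ((continuous_bumpPotential.mul (by fun_prop)).integrable_of_hasCompactSupport
            hasCompactSupport_bumpPotential.mul_right) fun z => ?_
        exact mul_le_mul_of_nonneg_left (hvK _) (bumpPotential_nonneg z)
      nlinarith)
  have h := hmono (mem_Ici.2 le_rfl) (mem_Ici.2 hρ) hρ
  simp only [zero_smul, add_zero, integral_mul_const] at h
  have h2 : K * ρ ^ 2 / 2 * J ≤ K * ρ ^ 2 / 2 * ((∫ z, bumpWeight n z) / 4) :=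
    mul_le_mul_of_nonneg_left hJ (by positivity)
  linarith

theorem lapl_congr {v w : EuclideanSpace ℝ (Fin n) → ℝ} {x : EuclideanSpace ℝ (Fin n)}
    (h : v =ᶠ[𝓝 x] w) : lapl n v x = lapl n w x := by
  refine Finset.sum_congr rfl fun j _ => ?_
  have : (fun y => fderiv ℝ v y (EuclideanSpace.single j (1 : ℝ))) =ᶠ[𝓝 x]
      fun y => fderiv ℝ w y (EuclideanSpace.single j (1 : ℝ)) :=
    (h.fderiv (𝕜 := ℝ)).mono fun y hy => congrArg (fun L => L (EuclideanSpace.single j 1)) hy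
  rw [this.fderiv_eq]

theorem lapl_neg (u : EuclideanSpace ℝ (Fin n) → ℝ) (x : EuclideanSpace ℝ (Fin n)) :
    lapl n (fun y => -u y) x = -lapl n u x := by
  simp [lapl, fderiv_fun_neg]

theorem lapl_sub_const (u : EuclideanSpace ℝ (Fin n) → ℝ) (c : ℝ)
    (x : EuclideanSpace ℝ (Fin n)) : lapl n (fun y => u y - c) x = lapl n u x := by
  simp [lapl, fderiv_sub_const]

theorem volume_preimage_affine (y : EuclideanSpace ℝ (Fin n)) {ρ : ℝ} (hρ : ρ ≠ 0)
    (T : Set (EuclideanSpace ℝ (Fin n))) :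
    volume ((fun z => y + ρ • z) ⁻¹' T) = ENNReal.ofReal |(ρ ^ n)⁻¹| * volume T := by
  have h := Measure.addHaar_preimage_smul volume hρ ((fun z => y + z) ⁻¹' T)
  rw [measure_preimage_add, finrank_euclideanSpace_fin] at h
  exact h

theorem preimage_affine_ball (y : EuclideanSpace ℝ (Fin n)) {ρ : ℝ} (hρ : 0 < ρ) :
    (fun z => y + ρ • z) ⁻¹' ball y ρ = ball 0 1 := by
  ext z
  simp [norm_smul, abs_of_pos hρ, hρ]

/-- The weighted mean of a bounded function supported in a set of small density. -/
theorem integral_bumpWeight_mul_le {v : EuclideanSpace ℝ (Fin n) → ℝ} (hv : Continuous v)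
    {Ω : Set (EuclideanSpace ℝ (Fin n))} (hΩ : IsOpen Ω) {A c ρ : ℝ} (hA : 0 ≤ A)
    (hvA : ∀ x, v x ≤ A) (hv0 : ∀ x ∉ Ω, v x = 0) (y : EuclideanSpace ℝ (Fin n)) (hρ : 0 < ρ)
    (hd : (volume (Ω ∩ ball y ρ)).toReal ≤ c * (volume (ball y ρ)).toReal) :
    ∫ z, bumpWeight n z * v (y + ρ • z) ≤
      4 * A * (c * (volume (ball (0 : EuclideanSpace ℝ (Fin n)) 1)).toReal) := by
  set S : Set (EuclideanSpace ℝ (Fin n)) := (fun z => y + ρ • z) ⁻¹' (Ω ∩ ball y ρ) with hS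
  have hSo : IsOpen S := (hΩ.inter isOpen_ball).preimage (by fun_prop)
  have hSv : (volume S).toReal ≤
      c * (volume (ball (0 : EuclideanSpace ℝ (Fin n)) 1)).toReal := by
    rw [← preimage_affine_ball y hρ, hS, volume_preimage_affine y hρ.ne',
      volume_preimage_affine y hρ.ne', ENNReal.toReal_mul, ENNReal.toReal_mul, mul_left_comm]
    exact mul_le_mul_of_nonneg_left hd ENNReal.toReal_nonneg
  have hSf : volume S ≠ ⊤ := by
    refine ne_top_of_le_ne_top (measure_ball_lt_top (x := (0 : EuclideanSpace ℝ (Fin n)))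
      (r := 1)).ne (measure_mono ?_)
    rw [← preimage_affine_ball y hρ]
    exact preimage_mono inter_subset_right
  calc ∫ z, bumpWeight n z * v (y + ρ • z)
      ≤ ∫ z, S.indicator (fun _ => 4 * A) z := by
        refine integral_mono ((continuous_bumpWeight.mul
          (by fun_prop)).integrable_of_hasCompactSupport hasCompactSupport_bumpWeight.mul_right)
          ((integrable_indicator_iff hSo.measurableSet).2 (integrableOn_const hSf)) fun z => ?_
        by_cases hz : z ∈ S
        · simp only [indicator_of_mem hz]
          exact (mul_le_mul_of_nonneg_left (hvA _) (bumpWeight_nonneg z)).trans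
            (mul_le_mul_of_nonneg_right (bumpWeight_le z) hA)
        · simp only [indicator_of_notMem hz]
          by_cases hz1 : z ∈ ball (0 : EuclideanSpace ℝ (Fin n)) 1
          · have : y + ρ • z ∉ Ω := fun h => hz ⟨h, by
              rwa [← preimage_affine_ball y hρ] at hz1⟩
            simp [hv0 _ this]
          · simp [bumpWeight_eq_zero hz1]
    _ = 4 * A * (volume S).toReal := by
        rw [integral_indicator hSo.measurableSet, setIntegral_const, smul_eq_mul, mul_comm]
        rfl
    _ ≤ _ := mul_le_mul_of_nonneg_left hSv (by positivity)

/-- The density constant in the weak maximum principle on narrow sets. -/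
noncomputable def narrowConst (n : ℕ) : ℝ :=
  (∫ z, bumpWeight n z) / (64 * (volume (ball (0 : EuclideanSpace ℝ (Fin n)) 1)).toReal)

theorem volume_unitBall_toReal_pos :
    0 < (volume (ball (0 : EuclideanSpace ℝ (Fin n)) 1)).toReal :=
  ENNReal.toReal_pos (measure_ball_pos _ _ one_pos).ne' measure_ball_lt_top.ne

theorem narrowConst_pos : 0 < narrowConst n :=
  div_pos integral_bumpWeight_pos (mul_pos (by norm_num) volume_unitBall_toReal_pos)

/-- A one-sided form of the weak maximum principle, at an interior maximum point. -/
theorem le_three_mul_of_isMaxOn {u : EuclideanSpace ℝ (Fin n) → ℝ} (hu : ContDiff ℝ 2 u)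
    {Ω : Set (EuclideanSpace ℝ (Fin n))} (hΩ : IsOpen Ω) (hb : Bornology.IsBounded Ω)
    {lam m : ℝ} (hlam : 0 < lam) (hm : 0 ≤ m) (hlap : ∀ x ∈ Ω, lapl n u x = -lam * u x)
    (hfr : ∀ x ∈ frontier Ω, u x ≤ m) {y : EuclideanSpace ℝ (Fin n)} (hy : y ∈ Ω)
    (hmax : ∀ x ∈ Ω, u x ≤ u y) (hnar : IsNarrow n (narrowConst n) (1 / Real.sqrt lam) Ω) :
    u y ≤ 3 * m := by
  by_contra! hlt
  set M := u y with hM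
  obtain ⟨k, hk, hkM⟩ : ∃ k, m < k ∧ 3 * k < M := ⟨(m + M / 3) / 2, by linarith, by linarith⟩
  have hk0 : 0 < k := hm.trans_lt hk
  have hMk : 0 < M - k := by linarith
  have huc := hu.continuous
  let w : EuclideanSpace ℝ (Fin n) → ℝ := fun x => max (u x - k) 0 ^ 3
  let v : EuclideanSpace ℝ (Fin n) → ℝ := Ω.indicator w
  have hin : ∀ x ∈ Ω, v =ᶠ[𝓝 x] w := fun x hx => by
    filter_upwards [hΩ.mem_nhds hx] with z hz using indicator_of_mem hz _
  have hout : ∀ x ∉ Ω, v =ᶠ[𝓝 x] fun _ => 0 := fun x hx => by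
    by_cases hcl : x ∈ closure Ω
    · have hux : u x < k := (hfr x ⟨hcl, by rwa [hΩ.interior_eq]⟩).trans_lt hk
      filter_upwards [huc.continuousAt.eventually_lt continuousAt_const hux] with z hz
      refine indicator_apply_eq_zero.2 fun _ => ?_
      simp [w, max_eq_right (sub_nonpos.2 hz.le)]
    · filter_upwards [isClosed_closure.isOpen_compl.mem_nhds hcl] with z hz
      exact indicator_of_notMem (fun h => hz (subset_closure h)) _
  have huk : ContDiff ℝ 2 fun x => u x - k := hu.sub contDiff_const
  have hw : ContDiff ℝ 2 w := contDiff_two_max_zero_pow_three.comp huk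
  have hv : ContDiff ℝ 2 v := contDiff_iff_contDiffAt.2 fun x => by
    by_cases hx : x ∈ Ω
    · exact hw.contDiffAt.congr_of_eventuallyEq (hin x hx)
    · exact contDiffAt_const.congr_of_eventuallyEq (hout x hx)
  have hvc : HasCompactSupport v :=
    HasCompactSupport.intro hb.isCompact_closure fun x hx =>
      indicator_of_notMem (fun h => hx (subset_closure h)) _
  have hmk : ∀ x ∈ Ω, max (u x - k) 0 ≤ M - k := fun x hx =>
    max_le (by linarith [hmax x hx]) hMk.le
  set K := 3 * (M - k) ^ 2 * (lam * M)
  have hK : 0 ≤ K := by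
    have : 0 < M := by linarith
    positivity
  have hvK : ∀ x, -K ≤ lapl n v x := fun x => by
    by_cases hx : x ∈ Ω
    · have hwx : lapl n w x = 3 * (2 * max (u x - k) 0) *
          ∑ j, fderiv ℝ (fun x => u x - k) x (EuclideanSpace.single j 1) ^ 2 +
          3 * max (u x - k) 0 ^ 2 * lapl n u x := by
        rw [← lapl_sub_const u k x]
        exact lapl_comp huk
          (f := fun t => max t 0 ^ 3) (p := fun t => 3 * max t 0 ^ 2)
          (q := fun t => 3 * (2 * max t 0))
          (fun t => by
            simpa [show (1 : ℝ) + 2 = 3 by norm_num] using hasDerivAt_max_zero_pow 1 t)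
          (fun t => by simpa using (hasDerivAt_max_zero_pow 0 t).const_mul 3) x
      rw [lapl_congr (hin x hx), hwx, hlap x hx]
      have h0 : 0 ≤ max (u x - k) 0 := le_max_right _ _
      have h1 : 0 ≤ 3 * (2 * max (u x - k) 0) *
          ∑ j, fderiv ℝ (fun x => u x - k) x (EuclideanSpace.single j 1) ^ 2 :=
        mul_nonneg (by positivity) (Finset.sum_nonneg fun j _ => sq_nonneg _)
      have h2 : 3 * max (u x - k) 0 ^ 2 * (lam * u x) ≤ K := by
        have h3 : max (u x - k) 0 ^ 2 ≤ (M - k) ^ 2 := pow_le_pow_left₀ h0 (hmk x hx) 2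
        calc 3 * max (u x - k) 0 ^ 2 * (lam * u x)
            ≤ 3 * max (u x - k) 0 ^ 2 * (lam * M) := by
              have := hmax x hx
              gcongr
          _ ≤ K := by
              have : 0 < M := by linarith
              exact mul_le_mul_of_nonneg_right (by linarith) (by positivity)
      linarith
    · rw [lapl_congr (hout x hx)]
      simpa [lapl] using hK
  have hρ : 0 < 1 / Real.sqrt lam := by positivity
  have hρ2 : lam * (1 / Real.sqrt lam) ^ 2 = 1 := by
    rw [div_pow, Real.sq_sqrt hlam.le]
    field_simp
  have hA : 0 ≤ (M - k) ^ 3 := by positivity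
  have hvA : ∀ x, v x ≤ (M - k) ^ 3 := fun x =>
    indicator_apply_le' (fun hx => pow_le_pow_left₀ (le_max_right _ _) (hmk x hx) 3) fun _ => hA
  have hmean := mul_integral_bumpWeight_le hv hvc hK hvK y hρ.le
  have hdens := integral_bumpWeight_mul_le hv.continuous hΩ hA hvA
    (fun x hx => indicator_of_notMem hx _) y hρ (hnar y (subset_closure hy))
  have hvy : v y = (M - k) ^ 3 := by
    simp only [v, indicator_of_mem hy, w]
    rw [max_eq_left hMk.le]
  have hV := volume_unitBall_toReal_pos (n := n)
  have hI := integral_bumpWeight_pos (n := n)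
  have hc : narrowConst n * (volume (ball (0 : EuclideanSpace ℝ (Fin n)) 1)).toReal =
      (∫ z, bumpWeight n z) / 64 := by
    unfold narrowConst
    field_simp
  rw [hc] at hdens
  rw [hvy] at hmean
  have hKρ : K * (1 / Real.sqrt lam) ^ 2 = 3 * (M - k) ^ 2 * M := by
    linear_combination 3 * (M - k) ^ 2 * M * hρ2
  rw [hKρ] at hmean
  have h1 : ((M - k) ^ 3) * (∫ z, bumpWeight n z) ≤
      ((M - k) ^ 3 / 16 + 3 * (M - k) ^ 2 * M / 8) * ∫ z, bumpWeight n z := by linarith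
  have h2 := le_of_mul_le_mul_right h1 hI
  have h3 : (M - k) ^ 2 * (M - k) ≤ (M - k) ^ 2 * ((M - k) / 16 + 3 * M / 8) := by linarith
  have h4 := le_of_mul_le_mul_left h3 (by positivity)
  linarith

theorem biSup_nonneg {ι : Type*} (s : Set ι) {f : ι → ℝ} (hf : ∀ x, 0 ≤ f x) :
    0 ≤ ⨆ x ∈ s, f x :=
  Real.iSup_nonneg fun x => Real.iSup_nonneg fun _ => hf x

theorem le_biSup_of_bddAbove {ι : Type*} {s : Set ι} {f : ι → ℝ} (hf : ∀ x, 0 ≤ f x) {C : ℝ}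
    (hC : ∀ x ∈ s, f x ≤ C) {x : ι} (hx : x ∈ s) : f x ≤ ⨆ x ∈ s, f x := by
  have hC0 : 0 ≤ C := (hf x).trans (hC x hx)
  have h : BddAbove (range fun x => ⨆ _ : x ∈ s, f x) :=
    ⟨C, by rintro _ ⟨z, rfl⟩; exact Real.iSup_le (fun hz => hC z hz) hC0⟩
  simpa [hx] using le_ciSup h x

/-- A version of the weak maximum principle for eigenfunctions on narrow sets. -/
theorem stmt_4 (n : ℕ) (hn : 1 ≤ n) :
    ∃ c₀ : ℝ, 0 < c₀ ∧
      ∀ (lam r : ℝ) (x₀ : EuclideanSpace ℝ (Fin n))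
        (u : EuclideanSpace ℝ (Fin n) → ℝ) (U Ω : Set (EuclideanSpace ℝ (Fin n))),
        0 < lam → 0 < r →
        IsOpen U → closure (ball x₀ r) ⊆ U →
        ContDiff ℝ 2 u →
        (∀ y ∈ U, lapl n u y = -lam * u y) →
        IsOpen Ω → Ω ⊆ ball x₀ r →
        IsNarrow n c₀ (1 / Real.sqrt lam) Ω →
        (∀ x ∈ frontier Ω ∩ ball x₀ r, u x = 0) →
        (⨆ x ∈ Ω, |u x|) ≤ 3 * ⨆ x ∈ frontier Ω ∩ sphere x₀ r, |u x| := by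
  refine ⟨narrowConst n, narrowConst_pos, ?_⟩
  intro lam r x₀ u U Ω hlam hr _ hBU hu hlap hΩ hΩB hnar hzero
  have hb : Bornology.IsBounded Ω := isBounded_ball.subset hΩB
  have huc : Continuous fun x => |u x| := hu.continuous.abs
  have hcpt : IsCompact (closure Ω) := hb.isCompact_closure
  have hclB : closure Ω ⊆ closedBall x₀ r :=
    (closure_mono hΩB).trans closure_ball_subset_closedBall
  set m := ⨆ x ∈ frontier Ω ∩ sphere x₀ r, |u x| with hmdef
  have hm : 0 ≤ m := biSup_nonneg _ fun _ => abs_nonneg _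
  rcases Ω.eq_empty_or_nonempty with rfl | hne
  · simpa using hm
  obtain ⟨y, hycl, hymax⟩ := hcpt.exists_isMaxOn hne.closure huc.continuousOn
  have hmax : ∀ x ∈ closure Ω, |u x| ≤ |u y| := fun x hx => hymax hx
  have hfr : ∀ x ∈ frontier Ω, |u x| ≤ m := fun x hx => by
    rcases (mem_closedBall.1 (hclB hx.1)).lt_or_eq with h | h
    · rw [hzero x ⟨hx, h⟩, abs_zero]
      exact hm
    · exact le_biSup_of_bddAbove (s := frontier Ω ∩ sphere x₀ r) (f := fun x => |u x|)
        (fun _ => abs_nonneg _) (fun z hz => hmax z hz.1.1) ⟨hx, h⟩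
  have hlap' : ∀ x ∈ Ω, lapl n u x = -lam * u x := fun x hx =>
    hlap x (hBU (subset_closure (hΩB hx)))
  have hy : |u y| ≤ 3 * m := by
    by_cases hyΩ : y ∈ Ω
    · rcases abs_cases (u y) with ⟨h, _⟩ | ⟨h, _⟩
      · rw [h]
        exact le_three_mul_of_isMaxOn hu hΩ hb hlam hm hlap'
          (fun x hx => (le_abs_self _).trans (hfr x hx)) hyΩ
          (fun x hx => h ▸ (le_abs_self _).trans (hmax x (subset_closure hx))) hnar
      · rw [h]
        exact le_three_mul_of_isMaxOn (u := fun x => -u x) hu.neg hΩ hb hlam hm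
          (fun x hx => by rw [lapl_neg, hlap' x hx]; ring)
          (fun x hx => (neg_le_abs _).trans (hfr x hx)) hyΩ
          (fun x hx => h ▸ (neg_le_abs _).trans (hmax x (subset_closure hx))) hnar
    · linarith [hfr y ⟨hycl, by rwa [hΩ.interior_eq]⟩]
  exact Real.iSup_le (fun x => Real.iSup_le
    (fun hx => (hmax x (subset_closure hx)).trans hy) (by positivity)) (by positivity)
end

section
/- For every dimension n ≥ 1 there exist constants C > 0 and α ∈ (0,1) (depending only on n) such that for every λ > 0, every x₀ ∈ ℝⁿ, every r with 0 < r ≤ 1, and every λ-eigenfunction u on the ball B(x₀, 2r), one has sup_{B(x₀, r)} |u| ≤ C·e^{C√λ}·( sup_{B(x₀, r/2)} |u| )^α · ( sup_{B(x₀, 2r)} |u| )^{1−α}. -/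
open MeasureTheory Metric Set

open Filter Topology

lemma tendsto_symm_second_diff {g : ℝ → ℝ} (hg : ContDiff ℝ 2 g) :
    Tendsto (fun t => (g t + g (-t) - 2 * g 0) / t ^ 2) (𝓝[>] 0) (𝓝 (deriv (deriv g) 0)) := by
  have hd : ∀ t, HasDerivAt g (deriv g t) t := fun t =>
    (hg.differentiable (by norm_num) t).hasDerivAt
  have hg1 : ContDiff ℝ 1 (deriv g) := ((contDiff_succ_iff_deriv (n := 1)).1 hg).2.2
  have hdd : HasDerivAt (deriv g) (deriv (deriv g) 0) 0 :=
    (hg1.differentiable (by norm_num) 0).hasDerivAt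
  have hneg : ∀ {f : ℝ → ℝ} {f' t : ℝ}, HasDerivAt f f' (-t) →
      HasDerivAt (fun s => f (-s)) (-f') t := fun {f f' t} h => by
    simpa [Function.comp_def] using HasDerivAt.comp (𝕜 := ℝ) t h (hasDerivAt_neg t)
  refine HasDerivAt.lhopital_zero_nhdsGT (f' := fun t => deriv g t - deriv g (-t))
    (g' := fun t => 2 * t) ?_ ?_ ?_ ?_ ?_ ?_
  · refine Eventually.of_forall fun t => ?_
    simpa [sub_eq_add_neg] using ((hd t).add (hneg (hd (-t)))).sub_const (2 * g 0)
  · refine Eventually.of_forall fun t => ?_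
    simpa using hasDerivAt_pow 2 t
  · filter_upwards [self_mem_nhdsWithin] with t ht
    have : (0 : ℝ) < t := ht
    positivity
  · have hc : Continuous fun t => g t + g (-t) - 2 * g 0 := by
      have := hg.continuous
      fun_prop
    have := hc.tendsto 0
    simp only [neg_zero, ← two_mul, sub_self] at this
    exact this.mono_left nhdsWithin_le_nhds
  · have hc : Continuous fun t : ℝ => t ^ 2 := by fun_prop
    have := hc.tendsto 0
    simp only [ne_eq, OfNat.ofNat_ne_zero, not_false_eq_true, zero_pow] at this
    exact this.mono_left nhdsWithin_le_nhds
  · have h := (hdd.sub (hneg (f := deriv g) (f' := deriv (deriv g) 0) (t := 0) (by rwa [neg_zero]))).tendsto_slope_zero_right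
    have h2 := h.const_mul (1 / 2)
    refine (h2.congr' ?_).trans (le_of_eq ?_)
    · filter_upwards [self_mem_nhdsWithin] with t ht
      have : (0 : ℝ) < t := ht
      simp only [Pi.sub_apply, zero_add, neg_zero, sub_self, sub_zero, smul_eq_mul]
      field_simp
    · congr 1; ring

lemma tendsto_second_diff_fderiv {E : Type*} [NormedAddCommGroup E] [NormedSpace ℝ E]
    {u : E → ℝ} (hu : ContDiff ℝ 2 u) (y e : E) :
    Tendsto (fun t : ℝ => (u (y + t • e) + u (y - t • e) - 2 * u y) / t ^ 2) (𝓝[>] 0)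
      (𝓝 (fderiv ℝ (fun z => fderiv ℝ u z e) y e)) := by
  have hl : ∀ t : ℝ, HasDerivAt (fun t : ℝ => y + t • e) e t := fun t => by
    simpa using ((hasDerivAt_id t).smul_const e).const_add y
  have h1 : deriv (fun t : ℝ => u (y + t • e)) = fun t => fderiv ℝ u (y + t • e) e := by
    funext t
    exact ((hu.differentiable (by norm_num) _).hasFDerivAt.comp_hasDerivAt t (hl t)).deriv
  have hd : ContDiff ℝ 1 (fun z => fderiv ℝ u z e) :=
    (hu.fderiv_right (by norm_num)).clm_apply contDiff_const
  have h2 : deriv (deriv (fun t : ℝ => u (y + t • e))) 0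
      = fderiv ℝ (fun z => fderiv ℝ u z e) y e := by
    rw [h1]
    have := ((hd.differentiable (by norm_num) _).hasFDerivAt.comp_hasDerivAt 0 (hl 0)).deriv
    simpa [Function.comp_def] using this
  have hg : ContDiff ℝ 2 (fun t : ℝ => u (y + t • e)) := hu.comp (by fun_prop)
  have := tendsto_symm_second_diff hg
  rw [h2] at this
  simpa [sub_eq_add_neg] using this

lemma lapl_sub {n : ℕ} {u v : EuclideanSpace ℝ (Fin n) → ℝ} (hu : ContDiff ℝ 2 u)
    (hv : ContDiff ℝ 2 v) (x : EuclideanSpace ℝ (Fin n)) :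
    lapl n (fun y => u y - v y) x = lapl n u x - lapl n v x := by
  have hd : ∀ {w : EuclideanSpace ℝ (Fin n) → ℝ} (e : EuclideanSpace ℝ (Fin n)),
      ContDiff ℝ 2 w → DifferentiableAt ℝ (fun z => fderiv ℝ w z e) x := fun e hw =>
    ((hw.fderiv_right (m := 1) (by norm_num)).clm_apply contDiff_const).differentiable
      (by norm_num) x
  simp only [lapl, ← Finset.sum_sub_distrib]
  refine Finset.sum_congr rfl fun j _ => ?_
  have : (fun y => fderiv ℝ (fun y => u y - v y) y (EuclideanSpace.single j (1 : ℝ))) =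
      fun y => fderiv ℝ u y (EuclideanSpace.single j (1 : ℝ))
        - fderiv ℝ v y (EuclideanSpace.single j (1 : ℝ)) := by
    funext y
    rw [fderiv_fun_sub (hu.differentiable (by norm_num) y) (hv.differentiable (by norm_num) y)]
    rfl
  rw [this, fderiv_fun_sub (hd _ hu) (hd _ hv)]
  rfl

lemma lapl_comp_add_right {n : ℕ} (u : EuclideanSpace ℝ (Fin n) → ℝ)
    (x h : EuclideanSpace ℝ (Fin n)) :
    lapl n (fun y => u (y + h)) x = lapl n u (x + h) := by
  simp only [lapl]
  refine Finset.sum_congr rfl fun j _ => ?_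
  simp only [fderiv_comp_add_right]
  rw [fderiv_comp_add_right (f := fun y => fderiv ℝ u y (EuclideanSpace.single j (1 : ℝ)))]

lemma norm_reflect_coord {n : ℕ} (v : EuclideanSpace ℝ (Fin n)) (i : Fin n) :
    ‖v - (2 * v i) • EuclideanSpace.single i (1 : ℝ)‖ = ‖v‖ := by
  rw [← sq_eq_sq₀ (norm_nonneg _) (norm_nonneg _), norm_sub_sq_real, inner_smul_right,
    EuclideanSpace.inner_single_right, norm_smul, PiLp.norm_single, mul_pow]
  simp [mul_pow]
  ring

lemma half_ball_barrier {n : ℕ} {u : EuclideanSpace ℝ (Fin n) → ℝ} (hu : ContDiff ℝ 2 u)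
    {z : EuclideanSpace ℝ (Fin n)} {d M N B : ℝ} (hd : 0 < d)
    (hM : ∀ x ∈ closedBall z d, |u x| ≤ M) (hN : ∀ x ∈ closedBall z d, |lapl n u x| ≤ N)
    (hB0 : 0 ≤ B) (hB : 2 * n * M / d ^ 2 + N < 2 * B) (i : Fin n)
    {x : EuclideanSpace ℝ (Fin n)} (hx : x ∈ closedBall z d) (hxi : 0 ≤ (x - z) i) :
    (u x - u (x - (2 * (x - z) i) • EuclideanSpace.single i (1 : ℝ))) / 2 ≤
      M / d ^ 2 * ‖x - z‖ ^ 2 + B * ((x - z) i * (2 * d - (x - z) i)) := by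
  set e : Fin n → EuclideanSpace ℝ (Fin n) := fun j => EuclideanSpace.single j (1 : ℝ) with he
  set σ : EuclideanSpace ℝ (Fin n) → EuclideanSpace ℝ (Fin n) :=
    fun x => x - (2 * (x - z) i) • e i with hσ
  set w : EuclideanSpace ℝ (Fin n) → ℝ := fun x => (u x - u (σ x)) / 2 -
    (M / d ^ 2 * ‖x - z‖ ^ 2 + B * ((x - z) i * (2 * d - (x - z) i))) with hw
  set K : Set (EuclideanSpace ℝ (Fin n)) := closedBall z d ∩ {x | 0 ≤ (x - z) i} with hK
  have hM0 : 0 ≤ M := (abs_nonneg _).trans (hM z (mem_closedBall_self hd.le))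
  have hcoord : Continuous fun x : EuclideanSpace ℝ (Fin n) => (x - z) i := by fun_prop
  have hσc : Continuous σ := by
    simp only [hσ]; fun_prop
  have hwc : Continuous w := by
    have := hu.continuous
    have := this.comp hσc
    simp only [Function.comp_def] at this
    simp only [hw]
    fun_prop
  have hσz : ∀ x, ‖σ x - z‖ = ‖x - z‖ := fun x => by
    rw [← norm_reflect_coord (x - z) i, hσ]
    congr 1
    simp only [he]
    abel
  have hσK : ∀ x ∈ closedBall z d, σ x ∈ closedBall z d := fun x hx => by
    rw [mem_closedBall, dist_eq_norm] at hx ⊢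
    rwa [hσz]
  have hKc : IsCompact K :=
    (isCompact_closedBall z d).inter_right (isClosed_le continuous_const hcoord)
  obtain ⟨y, hyK, hmax⟩ := hKc.exists_isMaxOn ⟨x, hx, hxi⟩ hwc.continuousOn
  have hyn : ‖y - z‖ ≤ d := by simpa [dist_eq_norm] using hyK.1
  have hyi : 0 ≤ (y - z) i := hyK.2
  have hyid : (y - z) i ≤ d :=
    ((le_abs_self _).trans (PiLp.norm_apply_le (y - z) i)).trans hyn
  suffices hwy : w y ≤ 0 by
    have := (hmax ⟨hx, hxi⟩ : w x ≤ w y).trans hwy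
    simp only [hw] at this
    linarith
  have hq : 0 ≤ B * ((y - z) i * (2 * d - (y - z) i)) :=
    mul_nonneg hB0 (mul_nonneg hyi (by linarith))
  rcases hyi.eq_or_lt with h0 | hpos
  · have : σ y = y := by simp only [hσ, ← h0]; simp
    have h2 : 0 ≤ M / d ^ 2 * ‖y - z‖ ^ 2 := by positivity
    simp only [hw, this]
    linarith
  rcases hyn.eq_or_lt with h1 | hlt
  · have a1 := abs_le.1 (hM y hyK.1)
    have a2 := abs_le.1 (hM _ (hσK y hyK.1))
    have : M / d ^ 2 * ‖y - z‖ ^ 2 = M := by rw [h1]; field_simp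
    simp only [hw, this]
    linarith [a1.2, a2.1]
  exfalso
  have hnb : ∀ᶠ v in 𝓝 (0 : EuclideanSpace ℝ (Fin n)), y + v ∈ K := by
    have hK' : K ∈ 𝓝 y := by
      have h1 : ball z d ∈ 𝓝 y := isOpen_ball.mem_nhds (by simpa [dist_eq_norm] using hlt)
      have h2 : {x | 0 < (x - z) i} ∈ 𝓝 y :=
        (isOpen_lt continuous_const hcoord).mem_nhds hpos
      filter_upwards [h1, h2] with x h1 h2
      exact ⟨ball_subset_closedBall h1, le_of_lt h2⟩
    have : Tendsto (fun v => y + v) (𝓝 0) (𝓝 y) := by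
      have := (continuous_const_add y).tendsto (0 : EuclideanSpace ℝ (Fin n))
      simpa using this
    exact this hK'
  have key : ∀ j : Fin n, (fderiv ℝ (fun x => fderiv ℝ u x (e j)) y (e j) -
      fderiv ℝ (fun x => fderiv ℝ u x (e j)) (σ y) (e j)) / 2 ≤
        2 * M / d ^ 2 - (if j = i then 2 * B else 0) := by
    intro j
    have l1 := tendsto_second_diff_fderiv hu y (e j)
    have l2 := tendsto_second_diff_fderiv hu (σ y) (e j)
    refine le_of_tendsto ((l1.sub l2).div_const 2) ?_
    have ht0 : Tendsto (fun t : ℝ => t • e j) (𝓝[>] 0) (𝓝 0) := by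
      have : Continuous fun t : ℝ => t • e j := by fun_prop
      simpa using (this.tendsto 0).mono_left nhdsWithin_le_nhds
    have ht0' : Tendsto (fun t : ℝ => -(t • e j)) (𝓝[>] 0) (𝓝 0) := by simpa using ht0.neg
    filter_upwards [ht0.eventually hnb, ht0'.eventually hnb, self_mem_nhdsWithin] with t h1 h2 ht
    have ht : (0 : ℝ) < t := ht
    rw [← sub_eq_add_neg] at h2
    have m1 : w (y + t • e j) ≤ w y := hmax h1
    have m2 : w (y - t • e j) ≤ w y := hmax h2
    have hpar := parallelogram_law_with_norm ℝ (y - z) (t • e j)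
    have hen : ‖t • e j‖ ^ 2 = t ^ 2 := by simp [he, norm_smul]
    rw [hen, show y - z + t • e j = y + t • e j - z by abel,
      show y - z - t • e j = y - t • e j - z by abel] at hpar
    have c1 : (y + t • e j - z) i = (y - z) i + (if j = i then t else 0) := by
      simp [he, eq_comm]; ring
    have c2 : (y - t • e j - z) i = (y - z) i - (if j = i then t else 0) := by
      simp [he, eq_comm]; ring
    have s12 : u (σ (y + t • e j)) + u (σ (y - t • e j)) =
        u (σ y + t • e j) + u (σ y - t • e j) := by
      simp only [hσ, c1, c2]
      by_cases hji : j = i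
      · subst hji
        simp only [if_true]
        rw [add_comm]
        congr 2 <;> module
      · simp only [if_neg hji, add_zero, sub_zero]
        congr 2 <;> abel
    have hBq : B * ((y + t • e j - z) i * (2 * d - (y + t • e j - z) i)) +
        B * ((y - t • e j - z) i * (2 * d - (y - t • e j - z) i)) -
        2 * (B * ((y - z) i * (2 * d - (y - z) i))) = - t ^ 2 * (if j = i then 2 * B else 0) := by
      rw [c1, c2]
      split_ifs <;> ring
    simp only [hw] at m1 m2
    have hMq : M / d ^ 2 * ‖y + t • e j - z‖ ^ 2 + M / d ^ 2 * ‖y - t • e j - z‖ ^ 2 -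
        2 * (M / d ^ 2 * ‖y - z‖ ^ 2) = t ^ 2 * (2 * M / d ^ 2) := by
      linear_combination (M / d ^ 2) * hpar
    rw [← sub_div, div_div, div_le_iff₀ (by positivity)]
    nlinarith [m1, m2, s12, hBq, hMq]
  have hsum := Finset.sum_le_sum fun j (_ : j ∈ Finset.univ) => key j
  rw [← Finset.sum_div, Finset.sum_sub_distrib, Finset.sum_sub_distrib] at hsum
  simp only [Finset.sum_ite_eq', Finset.mem_univ, if_true, Finset.sum_const, Finset.card_univ,
    Fintype.card_fin, nsmul_eq_mul] at hsum
  have a1 := abs_le.1 (hN y hyK.1)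
  have a2 := abs_le.1 (hN _ (hσK y hyK.1))
  simp only [lapl] at a1 a2
  have : (n : ℝ) * (2 * M / d ^ 2) = 2 * n * M / d ^ 2 := by ring
  simp only [he] at hsum
  linarith [a1.1, a2.2]

lemma fderiv_single_le {n : ℕ} {u : EuclideanSpace ℝ (Fin n) → ℝ} (hu : ContDiff ℝ 2 u)
    {z : EuclideanSpace ℝ (Fin n)} {d M N : ℝ} (hd : 0 < d)
    (hM : ∀ x ∈ closedBall z d, |u x| ≤ M) (hN : ∀ x ∈ closedBall z d, |lapl n u x| ≤ N)
    (i : Fin n) :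
    fderiv ℝ u z (EuclideanSpace.single i (1 : ℝ)) ≤ 2 * n * M / d + N * d := by
  set e := EuclideanSpace.single i (1 : ℝ) with he
  have hz := mem_closedBall_self (x := z) hd.le
  have hM0 : 0 ≤ M := (abs_nonneg _).trans (hM z hz)
  have hN0 : 0 ≤ N := (abs_nonneg _).trans (hN z hz)
  refine le_of_forall_pos_le_add fun ε hε => ?_
  set B := n * M / d ^ 2 + N / 2 + ε / (2 * d) with hB
  have hB0 : 0 ≤ B := by positivity
  have hBlt : 2 * n * M / d ^ 2 + N < 2 * B := by
    have : 0 < ε / (2 * d) := by positivity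
    have h2 : 2 * n * M / d ^ 2 = 2 * (n * M / d ^ 2) := by ring
    rw [hB, h2]; linarith
  have hl : ∀ s : ℝ, HasDerivAt (fun t : ℝ => u (z + t • (s • e))) (s * fderiv ℝ u z e) 0 := by
    intro s
    have h1 : HasDerivAt (fun t : ℝ => z + t • (s • e)) (s • e) 0 := by
      simpa using ((hasDerivAt_id (0 : ℝ)).smul_const (s • e)).const_add z
    have h2 := (hu.differentiable (by norm_num)
      (z + (0 : ℝ) • (s • e))).hasFDerivAt.comp_hasDerivAt 0 h1
    simpa [Function.comp_def] using h2
  have hlim := ((hl 1).sub (hl (-1))).tendsto_slope_zero_right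
  have hlim2 : Tendsto (fun t : ℝ => 2 * (M / d ^ 2 * t + B * (2 * d - t))) (𝓝[>] 0)
      (𝓝 (2 * (M / d ^ 2 * 0 + B * (2 * d - 0)))) := by
    have : Continuous fun t : ℝ => 2 * (M / d ^ 2 * t + B * (2 * d - t)) := by fun_prop
    exact (this.tendsto 0).mono_left nhdsWithin_le_nhds
  have hle := le_of_tendsto_of_tendsto hlim hlim2 (by
    filter_upwards [Ioc_mem_nhdsGT hd] with t ht
    have hc : (z + t • e - z) i = t := by simp [he]
    have hen : ‖z + t • e - z‖ = t := by simp [he, norm_smul, abs_of_pos ht.1]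
    have := half_ball_barrier hu hd hM hN hB0 hBlt i (x := z + t • e)
      (by rw [mem_closedBall, dist_eq_norm, hen]; exact ht.2) (by rw [hc]; exact ht.1.le)
    rw [hc, hen, ← he, show z + t • e - (2 * t) • e = z + t • ((-1 : ℝ) • e) by module] at this
    have ht0 := ht.1
    simp only [Pi.sub_apply, zero_add, zero_smul, add_zero, sub_self, sub_zero, one_smul,
      smul_eq_mul]
    rw [inv_mul_le_iff₀ ht0]
    linarith)
  have hBd : 2 * (B * (2 * d)) = 2 * (2 * n * M / d + N * d + ε) := by
    rw [hB]; field_simp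
  linarith

lemma norm_fderiv_apply_le {n : ℕ} {u : EuclideanSpace ℝ (Fin n) → ℝ} (hu : ContDiff ℝ 2 u)
    {z : EuclideanSpace ℝ (Fin n)} {d M N : ℝ} (hd : 0 < d)
    (hM : ∀ x ∈ closedBall z d, |u x| ≤ M) (hN : ∀ x ∈ closedBall z d, |lapl n u x| ≤ N) :
    ‖fderiv ℝ u z‖ ≤ n * (2 * n * M / d + N * d) := by
  have hz := mem_closedBall_self (x := z) hd.le
  have hM0 : 0 ≤ M := (abs_nonneg _).trans (hM z hz)
  have hN0 : 0 ≤ N := (abs_nonneg _).trans (hN z hz)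
  have hneg : ∀ x, lapl n (fun y => 0 - u y) x = - lapl n u x := fun x => by
    rw [lapl_sub contDiff_const hu]
    simp [lapl]
  have hcoord : ∀ i : Fin n, |fderiv ℝ u z (EuclideanSpace.single i (1 : ℝ))| ≤
      2 * n * M / d + N * d := by
    intro i
    refine abs_le'.2 ⟨fderiv_single_le hu hd hM hN i, ?_⟩
    have := fderiv_single_le (u := fun y => 0 - u y) (contDiff_const.sub hu) hd (M := M) (N := N)
      (by simpa using hM) (by simpa only [hneg, abs_neg] using hN) i
    simpa using this
  refine ContinuousLinearMap.opNorm_le_bound _ (by positivity) fun h => ?_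
  have hrep : h = ∑ i, h i • EuclideanSpace.single i (1 : ℝ) := by
    simpa using ((EuclideanSpace.basisFun (Fin n) ℝ).sum_repr h).symm
  conv_lhs => rw [hrep]
  rw [map_sum]
  refine (norm_sum_le _ _).trans ?_
  have : ∀ i ∈ Finset.univ, ‖fderiv ℝ u z (h i • EuclideanSpace.single i (1 : ℝ))‖ ≤
      ‖h‖ * (2 * n * M / d + N * d) := fun i _ => by
    rw [map_smul, norm_smul]
    exact mul_le_mul (PiLp.norm_apply_le h i) (hcoord i) (norm_nonneg _) (norm_nonneg _)
  refine (Finset.sum_le_sum this).trans (le_of_eq ?_)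
  simp
  ring

lemma abs_fwdDiff_iter_le_of_eigen {n : ℕ} {lam d : ℝ} (hlam : 0 ≤ lam) (hd : 0 < d)
    (p h : EuclideanSpace ℝ (Fin n)) (j : ℕ) :
    ∀ (u : EuclideanSpace ℝ (Fin n) → ℝ) (R M : ℝ), ContDiff ℝ 2 u →
      (∀ x ∈ ball p R, lapl n u x = -lam * u x) → (∀ x ∈ ball p R, |u x| ≤ M) →
      j * (‖h‖ + d) < R →
      |(fwdDiff h)^[j] u p| ≤ (‖h‖ * (n * (2 * n / d + lam * d))) ^ j * M := by
  induction j with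
  | zero =>
    intro u R M _ _ hM hR
    simpa using hM p (mem_ball_self (by simpa using hR))
  | succ j ih =>
    intro u R M hu heq hM hR
    push_cast at hR
    have hshift : ∀ x ∈ ball p (R - (‖h‖ + d)), x + h ∈ ball p R := fun x hx => by
      rw [mem_ball, dist_eq_norm] at hx ⊢
      have := norm_add_le (x - p) h
      rw [show x + h - p = x - p + h by abel]
      linarith
    have hsub : ball p (R - (‖h‖ + d)) ⊆ ball p R := ball_subset_ball (by linarith [norm_nonneg h])
    have hcomp : ContDiff ℝ 2 fun x => u (x + h) := hu.comp (contDiff_id.add contDiff_const)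
    rw [Function.iterate_succ_apply]
    refine (ih (fwdDiff h u) (R - (‖h‖ + d)) (‖h‖ * (n * (2 * n / d + lam * d)) * M)
      (hcomp.sub hu) ?_ ?_ (by linarith)).trans (le_of_eq (by ring))
    · intro x hx
      have : lapl n (fwdDiff h u) x = lapl n (fun y => u (y + h) - u y) x := rfl
      rw [this, lapl_sub hcomp hu, lapl_comp_add_right, heq _ (hshift x hx), heq _ (hsub hx),
        fwdDiff]
      ring
    · intro x hx
      have hgrad : ∀ z ∈ ball p (R - d), ‖fderiv ℝ u z‖ ≤
          n * (2 * n * M / d + lam * M * d) := by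
        intro z hz
        have hcb : closedBall z d ⊆ ball p R := fun y hy => by
          rw [mem_ball] at hz ⊢
          rw [mem_closedBall] at hy
          linarith [dist_triangle y z p]
        refine norm_fderiv_apply_le hu hd (fun y hy => hM y (hcb hy)) fun y hy => ?_
        rw [heq y (hcb hy), abs_mul, abs_neg, abs_of_nonneg hlam]
        exact mul_le_mul_of_nonneg_left (hM y (hcb hy)) hlam
      have hx1 : x ∈ ball p (R - d) := ball_subset_ball (by linarith [norm_nonneg h]) hx
      have hx2 : x + h ∈ ball p (R - d) := by
        rw [mem_ball, dist_eq_norm] at hx ⊢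
        have := norm_add_le (x - p) h
        rw [show x + h - p = x - p + h by abel]
        linarith
      have := (convex_ball p (R - d)).norm_image_sub_le_of_norm_fderiv_le (𝕜 := ℝ)
        (fun y _ => hu.differentiable (by norm_num) y) hgrad hx1 hx2
      rw [add_sub_cancel_left] at this
      refine this.trans (le_of_eq ?_)
      ring

lemma abs_fwdDiff_iter_le_of_forall_le {E : Type*} [AddCommMonoid E] (u : E → ℝ) (h : E) {m : ℝ}
    (j : ℕ) : ∀ x : E, (∀ i ≤ j, |u (x + i • h)| ≤ m) → |(fwdDiff h)^[j] u x| ≤ 2 ^ j * m := by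
  induction j with
  | zero => intro x hx; simpa using hx 0 le_rfl
  | succ j ih =>
    intro x hx
    rw [Function.iterate_succ_apply', fwdDiff]
    have h1 := ih x fun i hi => hx i (by omega)
    have h2 := ih (x + h) fun i hi => by
      have := hx (i + 1) (by omega)
      rwa [add_smul, one_smul, add_comm (i • h) h, ← add_assoc] at this
    have h3 := abs_sub ((fwdDiff h)^[j] u (x + h)) ((fwdDiff h)^[j] u x)
    calc _ ≤ _ := h3
      _ ≤ 2 ^ j * m + 2 ^ j * m := add_le_add h2 h1
      _ = _ := by ring

lemma one_add_sq_div_pow_le_exp {y : ℝ} (hy : 0 ≤ y) {j : ℕ} (hj : 0 < j) :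
    (1 + (y / j) ^ 2) ^ j ≤ Real.exp (2 * y) := by
  have hj' : (0 : ℝ) < j := by exact_mod_cast hj
  have h0 : 0 ≤ y / j := by positivity
  have h1 : 1 + (y / j) ^ 2 ≤ Real.exp (2 * (y / j)) := by
    have := Real.add_one_le_exp (y / j)
    rw [two_mul, Real.exp_add]
    nlinarith
  calc (1 + (y / j) ^ 2) ^ j ≤ Real.exp (2 * (y / j)) ^ j := by gcongr
    _ = Real.exp (2 * y) := by
      rw [← Real.exp_nat_mul]
      congr 1
      field_simp

lemma abs_le_pow_add_of_eigen {n : ℕ} (hn : 1 ≤ n) {lam a m M : ℝ} (hlam : 0 ≤ lam) (ha : 0 < a)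
    {p y : EuclideanSpace ℝ (Fin n)} {u : EuclideanSpace ℝ (Fin n) → ℝ} (hu : ContDiff ℝ 2 u)
    (heq : ∀ x ∈ ball p (2 * a + 32 * n ^ 2 * a), lapl n u x = -lam * u x)
    (hM : ∀ x ∈ ball p (2 * a + 32 * n ^ 2 * a), |u x| ≤ M)
    (hm : ∀ x ∈ ball p a, |u x| ≤ m) (hy : y ∈ ball p (2 * a)) {k : ℕ} (hk : 1 ≤ k) :
    |u y| ≤ 8 ^ k * m + (1 / 2) ^ k * (Real.exp (2 * (√lam * (32 * n ^ 2 * a))) * M) := by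
  set ρ : ℝ := 32 * n ^ 2 * a with hρ
  have hn' : (1 : ℝ) ≤ n := by exact_mod_cast hn
  have hk' : (1 : ℝ) ≤ k := by exact_mod_cast hk
  have hρ0 : 0 < ρ := by positivity
  have hm0 : 0 ≤ m := (abs_nonneg _).trans (hm p (mem_ball_self ha))
  have hM0 : 0 ≤ M := (abs_nonneg _).trans (hM p (mem_ball_self (by positivity)))
  set E := Real.exp (2 * (√lam * ρ)) with hE
  set h : EuclideanSpace ℝ (Fin n) := (2 * k : ℝ)⁻¹ • (y - p) with hh
  have hyh : y = p + (2 * k) • h := by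
    rw [hh, ← Nat.cast_smul_eq_nsmul ℝ, smul_smul]
    push_cast
    rw [mul_inv_cancel₀ (by positivity), one_smul]
    abel
  have hkh : k * ‖h‖ < a := by
    rw [mem_ball, dist_eq_norm] at hy
    rw [hh, norm_smul, norm_inv, Real.norm_of_nonneg (by positivity)]
    field_simp
    linarith
  have hbound : ∀ j ∈ Finset.range (2 * k + 1),
      |(2 * k).choose j • (fwdDiff h)^[j] u p| ≤
        (2 * k).choose j * (2 ^ k * m + (1 / 8) ^ k * (E * M)) := by
    intro j hj
    rw [nsmul_eq_mul, abs_mul, Nat.abs_cast]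
    refine mul_le_mul_of_nonneg_left ?_ (Nat.cast_nonneg _)
    have hj2 : j ≤ 2 * k := by simpa [Nat.lt_succ_iff] using hj
    have hnn1 : 0 ≤ 2 ^ k * m := by positivity
    have hnn2 : 0 ≤ (1 / 8) ^ k * (E * M) := by positivity
    rcases lt_or_ge j k with hjk | hjk
    · have := abs_fwdDiff_iter_le_of_forall_le u h j p (m := m) fun i hi => hm _ (by
        rw [mem_ball, dist_eq_norm, add_sub_cancel_left, ← Nat.cast_smul_eq_nsmul ℝ, norm_smul,
          Real.norm_of_nonneg (Nat.cast_nonneg i)]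
        have : (i : ℝ) ≤ k := by exact_mod_cast (hi.trans hjk.le)
        exact (mul_le_mul_of_nonneg_right this (norm_nonneg h)).trans_lt hkh)
      have h2 : (2 : ℝ) ^ j * m ≤ 2 ^ k * m := by gcongr; norm_num
      linarith
    · have hj0 : 0 < j := by omega
      have hj' : (0 : ℝ) < j := by exact_mod_cast hj0
      have hjh : j * ‖h‖ < 2 * a := by
        have : (j : ℝ) ≤ 2 * k := by exact_mod_cast hj2
        nlinarith [norm_nonneg h]
      have := abs_fwdDiff_iter_le_of_eigen hlam (d := ρ / j) (by positivity) p h j u _ M hu heq hM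
        (by rw [mul_add, mul_div_cancel₀ _ hj'.ne']; linarith)
      have hbase : ‖h‖ * (n * (2 * n / (ρ / j) + lam * (ρ / j))) ≤
          1 / 8 * (1 + (√lam * ρ / j) ^ 2) := by
        have e1 : ‖h‖ * (n * (2 * n / (ρ / j) + lam * (ρ / j))) =
            (j * ‖h‖) / ρ * (n * (2 * n + (√lam * ρ / j) ^ 2)) := by
          rw [div_pow, mul_pow, Real.sq_sqrt hlam]
          field_simp
        have e2 : (j * ‖h‖) / ρ ≤ 1 / (16 * n ^ 2) := by
          rw [div_le_div_iff₀ hρ0 (by positivity), hρ]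
          nlinarith [sq_nonneg (n : ℝ)]
        rw [e1]
        have hs := sq_nonneg (√lam * ρ / j)
        calc _ ≤ 1 / (16 * n ^ 2) * (n * (2 * n + (√lam * ρ / j) ^ 2)) := by gcongr
          _ ≤ 1 / (16 * n ^ 2) * (n * (2 * n * (1 + (√lam * ρ / j) ^ 2))) := by
            gcongr
            nlinarith
          _ = _ := by field_simp; ring
      have hpow : (‖h‖ * (n * (2 * n / (ρ / j) + lam * (ρ / j)))) ^ j ≤ (1 / 8) ^ k * E := by
        calc _ ≤ (1 / 8 * (1 + (√lam * ρ / j) ^ 2)) ^ j := by gcongr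
          _ = (1 / 8) ^ j * (1 + (√lam * ρ / j) ^ 2) ^ j := by rw [mul_pow]
          _ ≤ (1 / 8) ^ k * E := by
            refine mul_le_mul (pow_le_pow_of_le_one (by norm_num) (by norm_num) hjk)
              (one_add_sq_div_pow_le_exp (by positivity) hj0) (by positivity) (by positivity)
      have := this.trans (mul_le_mul_of_nonneg_right hpow hM0)
      linarith
  rw [hyh, shift_eq_sum_fwdDiff_iter h u (2 * k) p]
  refine (Finset.abs_sum_le_sum_abs _ _).trans ((Finset.sum_le_sum hbound).trans (le_of_eq ?_))
  rw [← Finset.sum_mul, ← Nat.cast_sum, Nat.sum_range_choose, pow_mul, mul_add, ← mul_assoc,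
    ← mul_assoc]
  push_cast
  rw [← mul_pow, ← mul_pow]
  norm_num

lemma le_four_mul_of_forall_pow {t q A : ℝ} (hq : 0 < q) (hA : 0 ≤ A) (ht : t ≤ A)
    (h : ∀ k : ℕ, 1 ≤ k → t ≤ 8 ^ k * (q ^ 4 * A) + (1 / 2) ^ k * A) : t ≤ 4 * q * A := by
  rcases le_or_gt 1 q with h1 | h1
  · nlinarith
  obtain ⟨k, hk1, hk2⟩ := exists_nat_pow_near (one_le_inv_iff₀.2 ⟨hq, h1.le⟩)
    (one_lt_two : (1 : ℝ) < 2)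
  have hq2 : 2 ^ k * q ≤ 1 := by
    rw [← div_inv_eq_mul, div_le_one (by positivity)]; exact hk1
  have hq3 : (1 / 2 : ℝ) ^ k ≤ 2 * q := by
    rw [one_div, inv_pow, inv_le_comm₀ (by positivity) (by positivity), mul_inv]
    rw [pow_succ] at hk2
    linarith
  rcases Nat.eq_zero_or_pos k with rfl | hk
  · norm_num at hq3
    nlinarith
  · have h8 : (8 : ℝ) ^ k * q ^ 4 ≤ q := by
      have : (8 : ℝ) ^ k = (2 ^ k) ^ 3 := by rw [← pow_mul, mul_comm, pow_mul]; norm_num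
      have h3 : (2 ^ k * q) ^ 3 ≤ 1 := pow_le_one₀ (by positivity) hq2
      calc _ = (2 ^ k * q) ^ 3 * q := by rw [this]; ring
        _ ≤ 1 * q := by gcongr
        _ = q := one_mul q
    have := h k hk
    nlinarith [mul_le_mul_of_nonneg_right h8 hA, mul_le_mul_of_nonneg_right hq3 hA]

lemma three_balls_of_bounds {n : ℕ} (hn : 1 ≤ n) {lam r m M : ℝ} (hlam : 0 < lam) (hr : 0 < r)
    (hr1 : r ≤ 1) (hm0 : 0 < m) (hM0 : 0 < M) {x₀ : EuclideanSpace ℝ (Fin n)}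
    {u : EuclideanSpace ℝ (Fin n) → ℝ} (hu : ContDiff ℝ 2 u)
    (heq : ∀ x ∈ ball x₀ (2 * r), lapl n u x = -lam * u x)
    (hM : ∀ x ∈ ball x₀ (2 * r), |u x| ≤ M) (hm : ∀ x ∈ ball x₀ (r / 2), |u x| ≤ m) :
    ∀ x ∈ ball x₀ r, |u x| ≤ 16 * Real.exp (16 * √lam) * m ^ ((1 / 4 : ℝ) ^ (1 + 16 * n ^ 2)) *
      M ^ (1 - (1 / 4 : ℝ) ^ (1 + 16 * n ^ 2)) := by
  set K : ℕ := 1 + 16 * n ^ 2 with hK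
  have hKpos : (1 : ℝ) ≤ K := by rw [hK]; push_cast; nlinarith [sq_nonneg (n : ℝ)]
  set a : ℝ := r / (2 * K) with ha
  have ha0 : 0 < a := by positivity
  have haK : K * a = r / 2 := by rw [ha]; field_simp
  have har : 2 * a + 32 * n ^ 2 * a = r := by
    rw [hK] at haK; push_cast at haK; linarith
  have hna : 0 ≤ 32 * (n : ℝ) ^ 2 * a := by positivity
  set M' := Real.exp (2 * √lam) * M with hM'
  have hM'0 : 0 < M' := by positivity
  have hMM' : M ≤ M' := le_mul_of_one_le_left hM0.le (Real.one_le_exp (by positivity))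
  set c := m / M' with hc
  have hc0 : 0 < c := by positivity
  have hcm : c * M' = m := by rw [hc]; field_simp
  have chain : ∀ i : ℕ, i ≤ K → ∀ y ∈ ball x₀ (r / 2 + i * a),
      |u y| ≤ 16 * c ^ ((1 / 4 : ℝ) ^ i) * M' := by
    intro i
    induction i with
    | zero =>
      intro _ y hy
      have := hm y (by simpa using hy)
      rw [pow_zero, Real.rpow_one, mul_assoc, hcm]
      linarith
    | succ i ih =>
      intro hi y hy
      have ih := ih (by omega)
      set s : ℝ := r / 2 + i * a with hs
      have hi' : ((i : ℝ) + 1) ≤ K := by exact_mod_cast hi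
      have hsa : s + a ≤ r := by
        have := mul_le_mul_of_nonneg_right hi' ha0.le
        rw [hs]; linarith
      have has : a ≤ s := by
        have : 0 ≤ i * a := by positivity
        have : 1 * a ≤ K * a := mul_le_mul_of_nonneg_right hKpos ha0.le
        rw [hs]; linarith
      have hs0 : 0 < s + a := by linarith
      rw [Nat.cast_succ, show r / 2 + (i + 1) * a = s + a by rw [hs]; ring, mem_ball,
        dist_eq_norm] at hy
      set p := x₀ + ((s - a) / (s + a)) • (y - x₀) with hp
      have hpx : dist p x₀ ≤ s - a := by
        rw [hp, dist_eq_norm, add_sub_cancel_left, norm_smul,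
          Real.norm_of_nonneg (div_nonneg (by linarith) hs0.le)]
        calc _ ≤ (s - a) / (s + a) * (s + a) :=
              mul_le_mul_of_nonneg_left hy.le (div_nonneg (by linarith) hs0.le)
          _ = s - a := by field_simp
      have hyp : y ∈ ball p (2 * a) := by
        have : y - p = (2 * a / (s + a)) • (y - x₀) := by
          have h1 : 2 * a / (s + a) = 1 - (s - a) / (s + a) := by field_simp; ring
          rw [h1, hp]; module
        rw [mem_ball, dist_eq_norm, this, norm_smul, Real.norm_of_nonneg (by positivity)]
        calc _ < 2 * a / (s + a) * (s + a) := mul_lt_mul_of_pos_left hy (by positivity)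
          _ = 2 * a := by field_simp
      have hbig : ball p (2 * a + 32 * n ^ 2 * a) ⊆ ball x₀ (2 * r) :=
        ball_subset_ball' (by linarith)
      have hsmall : ball p a ⊆ ball x₀ s := ball_subset_ball' (by linarith)
      set q := 2 * c ^ ((1 / 4 : ℝ) ^ (i + 1)) with hq
      have hq0 : 0 < q := by positivity
      have hq4 : q ^ 4 * M' = 16 * c ^ ((1 / 4 : ℝ) ^ i) * M' := by
        have he : (1 / 4 : ℝ) ^ (i + 1) * (4 : ℕ) = (1 / 4) ^ i := by
          push_cast; ring
        rw [hq, mul_pow, ← Real.rpow_natCast (c ^ _), ← Real.rpow_mul hc0.le, he]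
        norm_num
      have hyM : |u y| ≤ M := hM y (by rw [mem_ball, dist_eq_norm]; linarith)
      have := le_four_mul_of_forall_pow hq0 hM'0.le (hyM.trans hMM') fun k hk => by
        have h1 := abs_le_pow_add_of_eigen hn hlam.le ha0 hu (fun x hx => heq x (hbig hx))
          (fun x hx => hM x (hbig hx)) (fun x hx => ih x (hsmall hx)) hyp hk
        rw [hq4]
        refine h1.trans ?_
        rw [hM']
        gcongr
        exact mul_le_of_le_one_right (Real.sqrt_nonneg _) (by linarith)
      refine this.trans ?_
      rw [hq]
      have : 0 ≤ c ^ ((1 / 4 : ℝ) ^ (i + 1)) * M' := by positivity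
      linarith
  intro x hx
  refine (chain K le_rfl x (by rwa [haK, add_halves])).trans ?_
  set α := (1 / 4 : ℝ) ^ K with hα
  have hα0 : 0 < α := by positivity
  have e1 : 16 * c ^ α * M' = 16 * Real.exp (2 * √lam * (1 - α)) * m ^ α * M ^ (1 - α) := by
    have h1 : M' = M' ^ α * M' ^ (1 - α) := by
      rw [← Real.rpow_add hM'0, add_sub_cancel, Real.rpow_one]
    have h2 : M' ^ (1 - α) = Real.exp (2 * √lam * (1 - α)) * M ^ (1 - α) := by
      rw [hM', Real.mul_rpow (Real.exp_pos _).le hM0.le, ← Real.exp_mul]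
    have h3 : c ^ α * M' ^ α = m ^ α := by rw [← Real.mul_rpow hc0.le hM'0.le, hcm]
    calc 16 * c ^ α * M' = 16 * (c ^ α * M' ^ α) * M' ^ (1 - α) := by
          conv_lhs => rw [h1]
          ring
      _ = _ := by rw [h3, h2]; ring
  rw [e1]
  gcongr 16 * ?_ * _ * _
  refine Real.exp_le_exp.2 ?_
  nlinarith [Real.sqrt_nonneg lam, mul_nonneg (Real.sqrt_nonneg lam) hα0.le]

lemma abs_le_biSup_ball {E : Type*} [PseudoMetricSpace E] [ProperSpace E] {u : E → ℝ}
    (hu : Continuous u) {x₀ x : E} {s : ℝ} (hx : x ∈ ball x₀ s) :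
    |u x| ≤ ⨆ y ∈ ball x₀ s, |u y| := by
  obtain ⟨B, hB⟩ := (isCompact_closedBall x₀ s).exists_bound_of_continuousOn hu.continuousOn
  have hB0 : 0 ≤ B := (norm_nonneg _).trans (hB x (ball_subset_closedBall hx))
  have hbdd : BddAbove (range fun y => ⨆ _ : y ∈ ball x₀ s, |u y|) := by
    refine ⟨B, ?_⟩
    rintro _ ⟨y, rfl⟩
    exact Real.iSup_le (fun hy => hB y (ball_subset_closedBall hy)) hB0
  refine le_trans ?_ (le_ciSup hbdd x)
  rw [ciSup_pos hx]

/-- The three balls inequality for eigenfunctions. -/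
theorem stmt_8 (n : ℕ) (hn : 1 ≤ n) :
    ∃ (C α : ℝ), 0 < C ∧ 0 < α ∧ α < 1 ∧
      ∀ (lam : ℝ) (x₀ : EuclideanSpace ℝ (Fin n)) (r : ℝ)
        (u : EuclideanSpace ℝ (Fin n) → ℝ),
        0 < lam → 0 < r → r ≤ 1 →
        ContDiff ℝ 2 u →
        (∀ x ∈ ball x₀ (2 * r), lapl n u x = -lam * u x) →
        (⨆ x ∈ ball x₀ r, |u x|) ≤
          C * Real.exp (C * Real.sqrt lam) *
            (⨆ x ∈ ball x₀ (r / 2), |u x|) ^ α *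
            (⨆ x ∈ ball x₀ (2 * r), |u x|) ^ (1 - α) := by
  have hα1 : (1 / 4 : ℝ) ^ (1 + 16 * n ^ 2) < 1 :=
    pow_lt_one₀ (by norm_num) (by norm_num) (by omega)
  have hα0 : (0 : ℝ) < (1 / 4 : ℝ) ^ (1 + 16 * n ^ 2) := by positivity
  refine ⟨16, (1 / 4 : ℝ) ^ (1 + 16 * n ^ 2), by norm_num, hα0, hα1, ?_⟩
  intro lam x₀ r u hlam hr hr1 hu heq
  have hS : ∀ s, 0 ≤ ⨆ x ∈ ball x₀ s, |u x| := fun s =>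
    Real.iSup_nonneg fun x => Real.iSup_nonneg fun _ => abs_nonneg _
  set S₁ := ⨆ x ∈ ball x₀ (r / 2), |u x|
  set S₂ := ⨆ x ∈ ball x₀ (2 * r), |u x|
  have hS₁ : 0 ≤ S₁ := hS _
  have hS₂ : 0 ≤ S₂ := hS _
  set α := (1 / 4 : ℝ) ^ (1 + 16 * n ^ 2)
  have main : ∀ x ∈ ball x₀ r,
      |u x| ≤ 16 * Real.exp (16 * √lam) * S₁ ^ α * S₂ ^ (1 - α) := by
    intro x hx
    have hcont : Continuous fun ε : ℝ =>
        16 * Real.exp (16 * √lam) * (S₁ + ε) ^ α * (S₂ + ε) ^ (1 - α) :=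
      (continuous_const.mul ((continuous_const.add continuous_id).rpow_const
        fun _ => Or.inr hα0.le)).mul ((continuous_const.add continuous_id).rpow_const
        fun _ => Or.inr (sub_nonneg.2 hα1.le))
    have hlim := (hcont.tendsto 0).mono_left (nhdsWithin_le_nhds (s := Ioi 0))
    simp only [add_zero] at hlim
    refine ge_of_tendsto hlim ?_
    filter_upwards [self_mem_nhdsWithin] with ε hε
    have hε : 0 < ε := hε
    exact three_balls_of_bounds hn hlam hr hr1 (by positivity) (by positivity) hu heq
      (fun y hy => (abs_le_biSup_ball hu.continuous hy).trans (le_add_of_nonneg_right hε.le))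
      (fun y hy => (abs_le_biSup_ball hu.continuous hy).trans (le_add_of_nonneg_right hε.le)) x hx
  have hnn : 0 ≤ 16 * Real.exp (16 * √lam) * S₁ ^ α * S₂ ^ (1 - α) := by positivity
  exact Real.iSup_le (fun x => Real.iSup_le (fun hx => main x hx) hnn) hnn
end

section
/- Let λ ≥ 0, let U ⊆ ℝⁿ be a connected open neighborhood of 0, and let u : ℝⁿ → ℝ be a smooth function with Δu = −λu on U which is not identically zero on U. Then there exist a natural number d and a polynomial function P : ℝⁿ → ℝ, not identically zero, which is homogeneous of degree d (P(tx) = t^d·P(x) for all t > 0 and x ∈ ℝⁿ) and harmonic on ℝⁿ (ΔP ≡ 0), such that (u(x) − P(x))/‖x‖^d → 0 as x → 0. -/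
open MeasureTheory Metric Set Filter Topology

/-- `P : ℝⁿ → ℝ` is a polynomial function. -/
def IsPolyFun (n : ℕ) (P : EuclideanSpace ℝ (Fin n) → ℝ) : Prop :=
  ∃ p : MvPolynomial (Fin n) ℝ, ∀ x : EuclideanSpace ℝ (Fin n),
    P x = MvPolynomial.eval (fun i => x i) p


/-- The derivative of `f` along the vector `e`, as a function of the point. -/
noncomputable def dirDeriv {E : Type*} [NormedAddCommGroup E] [NormedSpace ℝ E] (e : E)
    (f : E → ℝ) (x : E) : ℝ :=
  fderiv ℝ f x e

section DirDeriv

variable {E : Type*} [NormedAddCommGroup E] [NormedSpace ℝ E]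

lemma contDiff_dirDeriv {f : E → ℝ} (hf : ContDiff ℝ (⊤ : ℕ∞) f) (e : E) :
    ContDiff ℝ (⊤ : ℕ∞) (dirDeriv e f) :=
  (hf.fderiv_right (m := (⊤ : ℕ∞)) (by simp)).clm_apply contDiff_const

lemma contDiff_dirDeriv_iterate {f : E → ℝ} (hf : ContDiff ℝ (⊤ : ℕ∞) f) (e : E) (k : ℕ) :
    ContDiff ℝ (⊤ : ℕ∞) ((dirDeriv e)^[k] f) := by
  induction k with
  | zero => exact hf
  | succ k ih =>
    rw [Function.iterate_succ_apply']
    exact contDiff_dirDeriv ih e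

lemma dirDeriv_comm {f : E → ℝ} (hf : ContDiff ℝ (⊤ : ℕ∞) f) (e h : E) :
    dirDeriv e (dirDeriv h f) = dirDeriv h (dirDeriv e f) := by
  have hd : Differentiable ℝ (fderiv ℝ f) :=
    (hf.fderiv_right (m := (⊤ : ℕ∞)) (by simp)).differentiable (by simp)
  have key : ∀ a b x, dirDeriv a (dirDeriv b f) x = fderiv ℝ (fderiv ℝ f) x a b := by
    intro a b x
    have h2 := (hd x).hasFDerivAt.clm_apply (hasFDerivAt_const b x)
    change fderiv ℝ (fun y => fderiv ℝ f y b) x a = _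
    rw [h2.fderiv]
    simp
  ext x
  rw [key, key]
  exact (hf.contDiffAt (x := x)).isSymmSndFDerivAt
    (by simpa using WithTop.coe_le_coe.2 (le_top : (2 : ℕ∞) ≤ ⊤)) e h

lemma dirDeriv_iterate_comm {f : E → ℝ} (hf : ContDiff ℝ (⊤ : ℕ∞) f) (e h : E) (k : ℕ) :
    (dirDeriv e)^[k] (dirDeriv h f) = dirDeriv h ((dirDeriv e)^[k] f) := by
  induction k with
  | zero => rfl
  | succ k ih =>
    rw [Function.iterate_succ_apply', ih, Function.iterate_succ_apply',
      dirDeriv_comm (contDiff_dirDeriv_iterate hf e k)]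

lemma hasDerivAt_line {f : E → ℝ} (hf : Differentiable ℝ f) (y e : E) (t : ℝ) :
    HasDerivAt (fun t : ℝ => f (y + t • e)) (dirDeriv e f (y + t • e)) t := by
  have h1 : HasDerivAt (fun t : ℝ => y + t • e) e t := by
    simpa using ((hasDerivAt_id t).smul_const e).const_add y
  exact (hf _).hasFDerivAt.comp_hasDerivAt t h1

lemma iteratedDeriv_line {f : E → ℝ} (hf : ContDiff ℝ (⊤ : ℕ∞) f) (y e : E) (k : ℕ) :
    iteratedDeriv k (fun t : ℝ => f (y + t • e)) =
      fun t => (dirDeriv e)^[k] f (y + t • e) := by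
  induction k with
  | zero => simp
  | succ k ih =>
    ext t
    rw [iteratedDeriv_succ, ih, Function.iterate_succ_apply']
    exact (hasDerivAt_line ((contDiff_dirDeriv_iterate hf e k).differentiable (by simp)) y e t).deriv

lemma iteratedFDeriv_succ_apply_eq_dirDeriv {f : E → ℝ} (hf : ContDiff ℝ (⊤ : ℕ∞) f) (k : ℕ)
    (x : E) (m : Fin (k + 1) → E) :
    iteratedFDeriv ℝ (k + 1) f x m =
      dirDeriv (m 0) (fun y => iteratedFDeriv ℝ k f y (Fin.tail m)) x := by
  have hd : Differentiable ℝ (iteratedFDeriv ℝ k f) :=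
    hf.differentiable_iteratedFDeriv (by exact_mod_cast WithTop.coe_lt_top _)
  rw [iteratedFDeriv_succ_apply_left]
  have h := (ContinuousMultilinearMap.apply ℝ (fun _ : Fin k => E) ℝ
    (Fin.tail m)).hasFDerivAt.comp x (hd x).hasFDerivAt
  exact (DFunLike.congr_fun h.fderiv (m 0)).symm

lemma iteratedFDeriv_const_eq {f : E → ℝ} (hf : ContDiff ℝ (⊤ : ℕ∞) f) (k : ℕ) (x e : E) :
    iteratedFDeriv ℝ k f x (fun _ => e) = (dirDeriv e)^[k] f x := by
  induction k generalizing x with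
  | zero => simp
  | succ k ih =>
    rw [iteratedFDeriv_succ_apply_eq_dirDeriv hf, Function.iterate_succ_apply']
    congr 1
    ext y
    exact ih y

lemma iteratedFDeriv_update_const {f : E → ℝ} (hf : ContDiff ℝ (⊤ : ℕ∞) f) (k : ℕ) (x e h : E)
    (i : Fin (k + 1)) :
    iteratedFDeriv ℝ (k + 1) f x (Function.update (fun _ => e) i h) =
      (dirDeriv e)^[k] (dirDeriv h f) x := by
  induction k generalizing x with
  | zero =>
    rw [iteratedFDeriv_succ_apply_eq_dirDeriv hf]
    obtain rfl : i = 0 := Fin.fin_one_eq_zero i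
    simp
  | succ k ih =>
    rw [iteratedFDeriv_succ_apply_eq_dirDeriv hf]
    refine Fin.cases ?_ (fun j => ?_) i
    · rw [Fin.tail_update_zero, Function.update_self, dirDeriv_iterate_comm hf]
      congr 1
      ext y
      exact iteratedFDeriv_const_eq hf (k + 1) y e
    · rw [Fin.tail_update_succ, Function.iterate_succ_apply',
        Function.update_of_ne (Fin.succ_ne_zero j).symm]
      congr 1
      ext y
      exact ih y j

lemma dirDeriv_iteratedFDeriv_diag {f : E → ℝ} (hf : ContDiff ℝ (⊤ : ℕ∞) f) (k : ℕ) (y h : E) :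
    dirDeriv h (fun x => iteratedFDeriv ℝ k f y (fun _ => x)) =
      fun x => k * iteratedFDeriv ℝ (k - 1) (dirDeriv h f) y (fun _ => x) := by
  ext x
  have h1 : HasFDerivAt (fun x : E => fun _ : Fin k => x)
      (ContinuousLinearMap.pi fun _ => ContinuousLinearMap.id ℝ E) x :=
    (ContinuousLinearMap.pi fun _ : Fin k => ContinuousLinearMap.id ℝ E).hasFDerivAt
  have h2 := ((iteratedFDeriv ℝ k f y).hasFDerivAt (x := fun _ => x)).comp x h1
  have h3 := DFunLike.congr_fun h2.fderiv h
  change fderiv ℝ ((iteratedFDeriv ℝ k f y) ∘ fun x => fun _ => x) x h = _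
  rw [h3]
  cases k with
  | zero => simp
  | succ k =>
    simp [iteratedFDeriv_update_const hf, iteratedFDeriv_const_eq (contDiff_dirDeriv hf h)]

lemma abs_sub_taylor_le {f : E → ℝ} (hf : ContDiff ℝ (⊤ : ℕ∞) f) (k : ℕ) (x e : E) {C : ℝ}
    (hC : ∀ t ∈ Icc (0 : ℝ) 1, |(dirDeriv e)^[k + 1] f (x + t • e)| ≤ C) :
    |f (x + e) - ∑ j ∈ Finset.range (k + 1), (j.factorial : ℝ)⁻¹ * (dirDeriv e)^[j] f x| ≤
      C / k.factorial := by
  set g : ℝ → ℝ := fun t => f (x + t • e) with hg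
  have hgs : ContDiff ℝ (⊤ : ℕ∞) g := hf.comp (by fun_prop)
  have hw : ∀ j, ∀ t ∈ Icc (0 : ℝ) 1,
      iteratedDerivWithin j g (Icc 0 1) t = (dirDeriv e)^[j] f (x + t • e) := by
    intro j t ht
    rw [iteratedDerivWithin_eq_iteratedDeriv (uniqueDiffOn_Icc zero_lt_one)
      ((hgs.of_le (by exact_mod_cast le_top)).contDiffAt) ht, hg, iteratedDeriv_line hf]
  have h := taylor_mean_remainder_bound (f := g) (a := 0) (b := 1) (C := C) (x := 1) (n := k)
    zero_le_one (hgs.of_le (by exact_mod_cast le_top)).contDiffOn (by simp)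
    (fun t ht => by rw [hw _ t ht]; exact hC t ht)
  rw [taylor_within_apply] at h
  have h0 : ∀ j, iteratedDerivWithin j g (Icc 0 1) 0 = (dirDeriv e)^[j] f x := by
    intro j
    rw [hw j 0 (by simp)]
    simp
  simp only [h0] at h
  simpa [hg] using h

end DirDeriv

lemma second_deriv_nonpos_of_isLocalMax {g g' : ℝ → ℝ} {s a : ℝ}
    (h1 : ∀ t, HasDerivAt g (g' t) t) (h2 : HasDerivAt g' s a) (hmax : IsLocalMax g a) :
    s ≤ 0 := by
  by_contra! hs
  have hg : deriv g = g' := funext fun t => (h1 t).deriv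
  have hmin : IsLocalMin g a := isLocalMin_of_deriv_deriv_pos (by rw [hg, h2.deriv]; exact hs)
    hmax.deriv_eq_zero (h1 a).continuousAt
  have hc : g =ᶠ[𝓝 a] fun _ => g a := by
    filter_upwards [hmax, hmin] with t ht ht' using le_antisymm ht ht'
  have hd := hc.deriv.deriv_eq
  rw [hg, h2.deriv] at hd
  simp at hd
  exact hs.ne' hd

lemma bernstein_line {V V' F F' : ℝ → ℝ} {V2 F2 ρ A B N c : ℝ}
    (hV : ∀ t, HasDerivAt V (V' t) t) (hV' : HasDerivAt V' V2 0)
    (hF : ∀ t, HasDerivAt F (F' t) t) (hF' : HasDerivAt F' F2 0)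
    (hmax : IsLocalMax (fun t => (ρ - (N + 2 * t * c + t ^ 2)) ^ 2 * V t ^ 2 + A * F t ^ 2 +
      B * (N + 2 * t * c + t ^ 2)) 0) :
    -24 * c ^ 2 * V 0 ^ 2 - 4 * (ρ - N) * V 0 ^ 2 + 2 * (ρ - N) ^ 2 * (V 0 * V2) +
      2 * A * (F' 0 ^ 2 + F 0 * F2) + 2 * B ≤ 0 := by
  have hq : ∀ t, HasDerivAt (fun t : ℝ => N + 2 * t * c + t ^ 2) (2 * c + 2 * t) t := by
    intro t
    have := ((((hasDerivAt_id t).const_mul 2).mul_const c).const_add N).add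
      ((hasDerivAt_id t).pow 2)
    convert! this using 1
    simp
  have hq' : HasDerivAt (fun t : ℝ => 2 * c + 2 * t) 2 0 := by
    simpa using ((hasDerivAt_id (0 : ℝ)).const_mul 2).const_add (2 * c)
  have h1 : ∀ t, HasDerivAt (fun t => (ρ - (N + 2 * t * c + t ^ 2)) ^ 2 * V t ^ 2 +
      A * F t ^ 2 + B * (N + 2 * t * c + t ^ 2))
      (-2 * ((ρ - (N + 2 * t * c + t ^ 2)) * (2 * c + 2 * t) * V t ^ 2) +
        2 * ((ρ - (N + 2 * t * c + t ^ 2)) ^ 2 * (V t * V' t)) + 2 * A * (F t * F' t) +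
        B * (2 * c + 2 * t)) t := by
    intro t
    have := ((((hq t).const_sub ρ).pow 2).mul ((hV t).pow 2)).add
      (((hF t).pow 2).const_mul A) |>.add ((hq t).const_mul B)
    convert! this using 1
    simp
    ring
  have h2 := (((((((hq 0).const_sub ρ).mul hq').mul ((hV 0).pow 2)).const_mul (-2)).add
    (((((hq 0).const_sub ρ).pow 2).mul ((hV 0).mul hV')).const_mul 2)).add
    (((hF 0).mul hF').const_mul (2 * A))).add (hq'.const_mul B)
  have h3 := second_deriv_nonpos_of_isLocalMax h1 (by convert! h2 using 1) hmax
  simp at h3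
  nlinarith [sq_nonneg ((ρ - N) * V' 0 - 4 * c * V 0)]

section EuclideanSpace

variable {n : ℕ}

local notation "𝔼" => EuclideanSpace ℝ (Fin n)

lemma lapl_eq_sum_dirDeriv (f : 𝔼 → ℝ) (x : 𝔼) :
    lapl n f x = ∑ j, dirDeriv (EuclideanSpace.single j 1) (dirDeriv (EuclideanSpace.single j 1) f) x :=
  rfl

lemma lapl_dirDeriv {f : 𝔼 → ℝ} (hf : ContDiff ℝ (⊤ : ℕ∞) f) {lam : ℝ} {U : Set 𝔼}
    (hU : IsOpen U) (heq : ∀ x ∈ U, lapl n f x = -lam * f x) (e : 𝔼) :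
    ∀ x ∈ U, lapl n (dirDeriv e f) x = -lam * dirDeriv e f x := by
  intro x hx
  have h1 : lapl n f =ᶠ[𝓝 x] fun y => -lam * f y := by
    filter_upwards [hU.mem_nhds hx] with y hy using heq y hy
  have h2 : dirDeriv e (lapl n f) x = -lam * dirDeriv e f x := by
    unfold dirDeriv
    rw [h1.fderiv_eq, fderiv_const_mul (hf.differentiable (by simp) x)]
    simp
  rw [← h2, lapl_eq_sum_dirDeriv]
  have h3 : lapl n f = ∑ j, dirDeriv (EuclideanSpace.single j 1)
      (dirDeriv (EuclideanSpace.single j 1) f) := by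
    ext y
    rw [lapl_eq_sum_dirDeriv, Finset.sum_apply]
  have hs := fun j : Fin n => contDiff_dirDeriv hf (EuclideanSpace.single j 1)
  rw [h3]
  conv_rhs => rw [dirDeriv]
  rw [fderiv_sum fun j _ => (contDiff_dirDeriv (hs j) _).differentiable (by simp) x,
    _root_.sum_apply]
  refine Finset.sum_congr rfl fun j _ => ?_
  rw [dirDeriv_comm hf, dirDeriv_comm (hs j)]
  rfl

lemma lapl_dirDeriv_iterate {f : 𝔼 → ℝ} (hf : ContDiff ℝ (⊤ : ℕ∞) f) {lam : ℝ} {U : Set 𝔼}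
    (hU : IsOpen U) (heq : ∀ x ∈ U, lapl n f x = -lam * f x) (e : 𝔼) (k : ℕ) :
    ∀ x ∈ U, lapl n ((dirDeriv e)^[k] f) x = -lam * (dirDeriv e)^[k] f x := by
  induction k with
  | zero => exact heq
  | succ k ih =>
    rw [Function.iterate_succ_apply']
    exact lapl_dirDeriv (contDiff_dirDeriv_iterate hf e k) hU ih e

lemma dirDeriv_eq_sum (f : 𝔼 → ℝ) (e x : 𝔼) :
    dirDeriv e f x = ∑ j, e j * dirDeriv (EuclideanSpace.single j 1) f x := by
  have he : e = ∑ j, e j • (EuclideanSpace.single j (1 : ℝ) : 𝔼) := by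
    ext i
    simp [Pi.single_apply]
  unfold dirDeriv
  conv_lhs => rw [he]
  rw [map_sum]
  simp

lemma dirDeriv_sq_le (f : 𝔼 → ℝ) (e x : 𝔼) (he : ‖e‖ ≤ 1) :
    dirDeriv e f x ^ 2 ≤ ∑ j, dirDeriv (EuclideanSpace.single j 1) f x ^ 2 := by
  rw [dirDeriv_eq_sum]
  refine (Finset.sum_mul_sq_le_sq_mul_sq _ _ _).trans ?_
  have h1 : ∑ j, e j ^ 2 ≤ 1 := by
    rw [← EuclideanSpace.real_norm_sq_eq]
    nlinarith [norm_nonneg e]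
  have h2 : 0 ≤ ∑ j, dirDeriv (EuclideanSpace.single j 1) f x ^ 2 := by positivity
  nlinarith

/-- Bernstein's interior gradient estimate for `Δf = -λf`. -/
lemma abs_dirDeriv_le {lam : ℝ} (hlam : 0 ≤ lam) {f : 𝔼 → ℝ} (hf : ContDiff ℝ (⊤ : ℕ∞) f)
    {x₀ : 𝔼} {r M : ℝ} (hr : 0 < r) (hr1 : r ≤ 1) (hM : 0 < M)
    (heq : ∀ x ∈ closedBall x₀ r, lapl n f x = -lam * f x)
    (heq' : ∀ e, ∀ x ∈ closedBall x₀ r, lapl n (dirDeriv e f) x = -lam * dirDeriv e f x)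
    (hb : ∀ x ∈ closedBall x₀ r, |f x| ≤ M) {e : 𝔼} (he : ‖e‖ ≤ 1) :
    |dirDeriv e f x₀| ≤ M * ((2 * n + 12 + lam) * (lam + 2) / r) := by
  rcases Nat.eq_zero_or_pos n with rfl | hn
  · obtain rfl : e = 0 := Subsingleton.elim _ _
    simp only [dirDeriv, map_zero, abs_zero]
    positivity
  have hn1 : (1 : ℝ) ≤ n := by exact_mod_cast hn
  set v := dirDeriv e f with hv
  have hvs : ContDiff ℝ (⊤ : ℕ∞) v := contDiff_dirDeriv hf e
  set A : ℝ := (2 * n + 12 + lam) * r ^ 2 with hA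
  set B : ℝ := A * (lam + 1) * M ^ 2 with hB
  have hA0 : 0 < A := by positivity
  have hB0 : 0 < B := by positivity
  set w : 𝔼 → ℝ := fun x =>
    (r ^ 2 - ‖x - x₀‖ ^ 2) ^ 2 * v x ^ 2 + A * f x ^ 2 + B * ‖x - x₀‖ ^ 2 with hw
  have hwc : Continuous w := by
    have := hvs.continuous
    have := hf.continuous
    fun_prop
  obtain ⟨y, hy, hmax⟩ := (isCompact_closedBall x₀ r).exists_isMaxOn
    ⟨x₀, mem_closedBall_self hr.le⟩ hwc.continuousOn
  have hyr : ‖y - x₀‖ ≤ r := by simpa [dist_eq_norm] using hy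
  have hfy : f y ^ 2 ≤ M ^ 2 := by
    rw [← sq_abs]
    exact pow_le_pow_left₀ (abs_nonneg _) (hb y hy) 2
  have hys : ‖y - x₀‖ = r := by
    by_contra hne
    have hlt : ‖y - x₀‖ < r := lt_of_le_of_ne hyr hne
    have hyb : closedBall x₀ r ∈ 𝓝 y :=
      mem_of_superset (isOpen_ball.mem_nhds (by simpa [dist_eq_norm] using hlt))
        ball_subset_closedBall
    have hloc : IsLocalMax w y := hmax.isLocalMax hyb
    set c : Fin n → ℝ := fun j => (y - x₀) j with hc
    set ε : Fin n → 𝔼 := fun j => EuclideanSpace.single j 1 with hε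
    have hN : ‖y - x₀‖ ^ 2 = ∑ j, c j ^ 2 := EuclideanSpace.real_norm_sq_eq _
    have hline : ∀ j, -24 * c j ^ 2 * v y ^ 2 - 4 * (r ^ 2 - ‖y - x₀‖ ^ 2) * v y ^ 2 +
        2 * (r ^ 2 - ‖y - x₀‖ ^ 2) ^ 2 * (v y * dirDeriv (ε j) (dirDeriv (ε j) v) y) +
        2 * A * (dirDeriv (ε j) f y ^ 2 + f y * dirDeriv (ε j) (dirDeriv (ε j) f) y) +
        2 * B ≤ 0 := by
      intro j
      have hloc' : IsLocalMax (fun t : ℝ => w (y + t • ε j)) 0 := by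
        have ht : Tendsto (fun t : ℝ => y + t • ε j) (𝓝 0) (𝓝 y) := by
          have : Continuous fun t : ℝ => y + t • ε j := by fun_prop
          simpa using this.tendsto 0
        have := ht.eventually hloc
        simpa [IsLocalMax, IsMaxFilter] using this
      have hnorm : ∀ t : ℝ, ‖y + t • ε j - x₀‖ ^ 2 = ‖y - x₀‖ ^ 2 + 2 * t * c j + t ^ 2 := by
        intro t
        rw [show y + t • ε j - x₀ = (y - x₀) + t • ε j by abel, norm_add_sq_real,
          real_inner_smul_right, norm_smul, hε, hc]
        simp [EuclideanSpace.inner_single_right]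
        ring
      have h0 := fun (g : 𝔼 → ℝ) (hg : ContDiff ℝ (⊤ : ℕ∞) g) =>
        hasDerivAt_line (hg.differentiable (by simp)) y (ε j)
      have := bernstein_line (h0 v hvs) (h0 _ (contDiff_dirDeriv hvs (ε j)) 0) (h0 f hf)
        (h0 _ (contDiff_dirDeriv hf (ε j)) 0) (ρ := r ^ 2) (A := A) (B := B)
        (N := ‖y - x₀‖ ^ 2) (c := c j) (by simpa only [hw, hnorm] using hloc')
      simpa using this
    have hsum := Finset.sum_nonpos fun j (_ : j ∈ Finset.univ) => hline j
    have hLv : ∑ j, dirDeriv (ε j) (dirDeriv (ε j) v) y = -lam * v y := heq' e y hy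
    have hLf : ∑ j, dirDeriv (ε j) (dirDeriv (ε j) f) y = -lam * f y := heq y hy
    simp only [Finset.sum_add_distrib, Finset.sum_sub_distrib, ← Finset.mul_sum,
      ← Finset.sum_mul, ← hN, hLv, hLf, Finset.sum_const, Finset.card_univ, Fintype.card_fin,
      nsmul_eq_mul] at hsum
    have hgrad : v y ^ 2 ≤ ∑ j, dirDeriv (ε j) f y ^ 2 := dirDeriv_sq_le f e y he
    set S := ∑ j, dirDeriv (ε j) f y ^ 2
    set N := ‖y - x₀‖ ^ 2
    have hN0 : 0 ≤ N := by positivity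
    have hNr : N ≤ r ^ 2 := pow_le_pow_left₀ (norm_nonneg _) hyr 2
    have h1 : A * v y ^ 2 ≤ A * S := mul_le_mul_of_nonneg_left hgrad hA0.le
    have h2 : A * lam * f y ^ 2 ≤ A * lam * M ^ 2 :=
      mul_le_mul_of_nonneg_left hfy (by positivity)
    have h3 : B ≤ n * B := le_mul_of_one_le_left hB0.le hn1
    have h4 : (r ^ 2 - N) ^ 2 ≤ r ^ 2 := by
      have : r ^ 2 ≤ 1 := pow_le_one₀ hr.le hr1
      nlinarith
    have h5 : 12 * N + 2 * n * (r ^ 2 - N) + lam * (r ^ 2 - N) ^ 2 ≤ A := by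
      have := mul_le_mul_of_nonneg_left h4 hlam
      have : 0 ≤ (n : ℝ) * N := by positivity
      rw [hA]
      nlinarith
    have h6 := mul_le_mul_of_nonneg_right h5 (sq_nonneg (v y))
    have h7 : 0 < A * M ^ 2 := by positivity
    rw [hB] at h3
    nlinarith
  have hle : r ^ 4 * v x₀ ^ 2 ≤ A * M ^ 2 + B * r ^ 2 := by
    have h := hmax (mem_closedBall_self hr.le)
    simp only [hw, mem_ofPred_eq, hys, sub_self, norm_zero] at h
    have h1 := mul_le_mul_of_nonneg_left hfy hA0.le
    have h2 : 0 ≤ A * f x₀ ^ 2 := by positivity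
    nlinarith
  have hr2 : r ^ 2 ≤ 1 := pow_le_one₀ hr.le hr1
  set K : ℝ := (2 * n + 12 + lam) * (lam + 2) with hK
  have hK1 : 1 ≤ K := by
    rw [hK]
    nlinarith
  have hle2 : r ^ 2 * v x₀ ^ 2 ≤ K * M ^ 2 := by
    have h1 : B * r ^ 2 ≤ B := mul_le_of_le_one_right hB0.le hr2
    have h2 : r ^ 2 * (r ^ 2 * v x₀ ^ 2) ≤ r ^ 2 * (K * M ^ 2) := by
      calc _ = r ^ 4 * v x₀ ^ 2 := by ring
        _ ≤ A * M ^ 2 + B := by linarith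
        _ = _ := by rw [hB, hA, hK]; ring
    exact le_of_mul_le_mul_left h2 (by positivity)
  have hfin : (r * v x₀) ^ 2 ≤ (K * M) ^ 2 := by
    have : 0 ≤ M ^ 2 := by positivity
    nlinarith
  have h := abs_le_of_sq_le_sq hfin (by positivity)
  rw [← mul_div_assoc, le_div_iff₀ hr]
  calc |v x₀| * r = |r * v x₀| := by rw [abs_mul, abs_of_pos hr]; ring
    _ ≤ K * M := h
    _ = M * K := by ring

/-- Iterated interior estimates, losing a distance `s` for each derivative. -/
lemma abs_dirDeriv_iterate_le {lam : ℝ} (hlam : 0 ≤ lam) {f : 𝔼 → ℝ}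
    (hf : ContDiff ℝ (⊤ : ℕ∞) f) {U : Set 𝔼} (hU : IsOpen U)
    (heq : ∀ x ∈ U, lapl n f x = -lam * f x) {s M : ℝ} (hs : 0 < s) (hs1 : s ≤ 1) (hM : 0 < M)
    {e : 𝔼} (he : ‖e‖ ≤ 1) (k : ℕ) (x : 𝔼) (hxU : closedBall x (k * s) ⊆ U)
    (hb : ∀ y ∈ closedBall x (k * s), |f y| ≤ M) :
    |(dirDeriv e)^[k] f x| ≤ M * ((2 * n + 12 + lam) * (lam + 2) / s) ^ k := by
  induction k generalizing x with
  | zero => simpa using hb x (by simp)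
  | succ k ih =>
    have hsub : ∀ y ∈ closedBall x s, closedBall y (k * s) ⊆ closedBall x ((k + 1 : ℕ) * s) := by
      intro y hy
      refine closedBall_subset_closedBall' ?_
      rw [mem_closedBall] at hy
      push_cast
      linarith
    have hxs : closedBall x s ⊆ U := fun y hy =>
      hxU (hsub y hy (mem_closedBall_self (by positivity)))
    rw [Function.iterate_succ_apply', pow_succ, ← mul_assoc]
    refine abs_dirDeriv_le hlam (contDiff_dirDeriv_iterate hf e k) hs hs1 (by positivity)
      (fun y hy => lapl_dirDeriv_iterate hf hU heq e k y (hxs hy))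
      (fun e' y hy => lapl_dirDeriv (contDiff_dirDeriv_iterate hf e k) hU
        (lapl_dirDeriv_iterate hf hU heq e k) e' y (hxs hy)) ?_ he
    exact fun y hy => ih y ((hsub y hy).trans hxU) fun z hz => hb z (hsub y hy hz)

lemma dirDeriv_iterate_smul {f : 𝔼 → ℝ} (hf : ContDiff ℝ (⊤ : ℕ∞) f) (c : ℝ) (e x : 𝔼) (k : ℕ) :
    (dirDeriv (c • e))^[k] f x = c ^ k * (dirDeriv e)^[k] f x := by
  rw [← iteratedFDeriv_const_eq hf, ← iteratedFDeriv_const_eq hf]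
  simpa using (iteratedFDeriv ℝ k f x).map_smul_univ (fun _ => c) fun _ => e

lemma dirDeriv_iterate_eventuallyEq_zero {f : 𝔼 → ℝ} {x : 𝔼} (h : f =ᶠ[𝓝 x] 0) (e : 𝔼) (k : ℕ) :
    (dirDeriv e)^[k] f =ᶠ[𝓝 x] 0 := by
  induction k with
  | zero => exact h
  | succ k ih =>
    rw [Function.iterate_succ_apply']
    filter_upwards [ih.fderiv (𝕜 := ℝ)] with y hy
    rw [dirDeriv, hy]
    simp

/-- A solution of `Δf = -λf` all of whose derivatives vanish at a point vanishes near it. -/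
lemma eventuallyEq_zero_of_flat {lam : ℝ} (hlam : 0 ≤ lam) {f : 𝔼 → ℝ}
    (hf : ContDiff ℝ (⊤ : ℕ∞) f) {U : Set 𝔼} (hU : IsOpen U)
    (heq : ∀ x ∈ U, lapl n f x = -lam * f x) {x : 𝔼} (hx : x ∈ U)
    (hflat : ∀ e k, (dirDeriv e)^[k] f x = 0) : f =ᶠ[𝓝 x] 0 := by
  obtain ⟨R₀, hR₀, hR₀U⟩ := nhds_basis_closedBall.mem_iff.1 (hU.mem_nhds hx)
  obtain ⟨R, hR, hR1, hR2⟩ : ∃ R : ℝ, 0 < R ∧ R ≤ 1 ∧ 2 * R ≤ R₀ :=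
    ⟨min 1 (R₀ / 2), by positivity, min_le_left _ _, by linarith [min_le_right 1 (R₀ / 2)]⟩
  have hRU : closedBall x (2 * R) ⊆ U := (closedBall_subset_closedBall hR2).trans hR₀U
  obtain ⟨M, hM, hbM⟩ : ∃ M : ℝ, 0 < M ∧ ∀ y ∈ closedBall x (2 * R), |f y| ≤ M := by
    obtain ⟨M, hM⟩ := (isCompact_closedBall x (2 * R)).exists_bound_of_continuousOn
      hf.continuous.continuousOn
    exact ⟨max M 1, by positivity, fun y hy => (hM y hy).trans (le_max_left _ _)⟩
  set K : ℝ := (2 * n + 12 + lam) * (lam + 2) with hK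
  have hK1 : 1 ≤ K := by
    have : (0 : ℝ) ≤ n := n.cast_nonneg
    rw [hK]
    nlinarith
  have hK0 : 0 < K := by linarith
  set δ : ℝ := R / (6 * K) with hδ
  have hδ0 : 0 < δ := by positivity
  have hδR : δ ≤ R := div_le_self hR.le (by linarith)
  filter_upwards [ball_mem_nhds x hδ0] with y hy
  set e : 𝔼 := δ⁻¹ • (y - x) with he
  have hye : y = x + δ • e := by
    rw [he, smul_inv_smul₀ hδ0.ne']
    abel
  have he1 : ‖e‖ ≤ 1 := by
    rw [he, norm_smul, norm_inv, Real.norm_of_nonneg hδ0.le, ← div_eq_inv_mul,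
      div_le_one hδ0, ← dist_eq_norm]
    exact hy.le
  have hbound : ∀ k : ℕ, |f y| ≤ M * ((k + 1 : ℕ) * (1 / 2) ^ (k + 1)) := by
    intro k
    have hk : (0 : ℝ) < (k + 1 : ℕ) := by positivity
    have hs : (0 : ℝ) < R / (k + 1 : ℕ) := by positivity
    have hks : ((k + 1 : ℕ) : ℝ) * (R / (k + 1 : ℕ)) = R := by field_simp
    have hder : ∀ t ∈ Icc (0 : ℝ) 1, |(dirDeriv (δ • e))^[k + 1] f (x + t • δ • e)| ≤
        δ ^ (k + 1) * (M * (K / (R / (k + 1 : ℕ))) ^ (k + 1)) := by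
      intro t ht
      rw [dirDeriv_iterate_smul hf, abs_mul, abs_of_pos (pow_pos hδ0 _)]
      refine mul_le_mul_of_nonneg_left ?_ (by positivity)
      have hz : closedBall (x + t • δ • e) ((k + 1 : ℕ) * (R / (k + 1 : ℕ))) ⊆
          closedBall x (2 * R) := by
        refine closedBall_subset_closedBall' ?_
        have : dist (x + t • δ • e) x ≤ R := by
          rw [dist_eq_norm, add_sub_cancel_left, norm_smul, norm_smul,
            Real.norm_of_nonneg ht.1, Real.norm_of_nonneg hδ0.le]
          calc t * (δ * ‖e‖) ≤ 1 * (δ * 1) := by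
                gcongr
                exact ht.2
            _ ≤ R := by linarith
        rw [hks]
        linarith
      exact abs_dirDeriv_iterate_le hlam hf hU heq hs
        ((div_le_self hR.le (by exact_mod_cast Nat.le_add_left 1 k)).trans hR1) hM he1 (k + 1) _
        (hz.trans hRU) fun z hz' => hbM z (hz hz')
    have h := abs_sub_taylor_le hf k x (δ • e) hder
    rw [Finset.sum_eq_zero fun j _ => by rw [hflat, mul_zero], sub_zero, ← hye] at h
    refine h.trans ?_
    have hexp : ((k + 1 : ℕ) : ℝ) ^ (k + 1) / (k + 1).factorial ≤ 3 ^ (k + 1) := by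
      refine (Real.pow_div_factorial_le_exp _ (Nat.cast_nonneg _) _).trans ?_
      rw [← Real.exp_one_pow]
      exact pow_le_pow_left₀ (Real.exp_pos 1).le Real.exp_one_lt_three.le _
    have hfac : ((k + 1).factorial : ℝ) = (k + 1 : ℕ) * k.factorial := by
      exact_mod_cast Nat.factorial_succ k
    have hδK : δ * (K / (R / (k + 1 : ℕ))) = (k + 1 : ℕ) * (1 / 6) := by
      rw [hδ]
      field_simp
    calc δ ^ (k + 1) * (M * (K / (R / (k + 1 : ℕ))) ^ (k + 1)) / k.factorial
        = M * (δ * (K / (R / (k + 1 : ℕ)))) ^ (k + 1) / k.factorial := by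
          rw [mul_pow]
          ring
      _ = M * ((k + 1 : ℕ) * (1 / 6) ^ (k + 1)) *
          (((k + 1 : ℕ) : ℝ) ^ (k + 1) / (k + 1).factorial) := by
          rw [hδK, mul_pow, hfac]
          field_simp
      _ ≤ M * ((k + 1 : ℕ) * (1 / 6) ^ (k + 1)) * 3 ^ (k + 1) := by gcongr
      _ = M * ((k + 1 : ℕ) * ((1 / 6) ^ (k + 1) * 3 ^ (k + 1))) := by ring
      _ = _ := by
          rw [← mul_pow]
          norm_num
  have hlim : Tendsto (fun k : ℕ => M * ((k + 1 : ℕ) * (1 / 2 : ℝ) ^ (k + 1))) atTop (𝓝 0) := by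
    have := ((tendsto_self_mul_const_pow_of_lt_one (r := (1 / 2 : ℝ)) (by norm_num)
      (by norm_num)).comp (tendsto_add_atTop_nat 1)).const_mul M
    simpa using this
  exact abs_nonpos_iff.1 (ge_of_tendsto' hlim hbound)

/-- Strong unique continuation for `Δf = -λf` on a connected open set. -/
lemma eqOn_zero_of_flat {lam : ℝ} (hlam : 0 ≤ lam) {f : 𝔼 → ℝ}
    (hf : ContDiff ℝ (⊤ : ℕ∞) f) {U : Set 𝔼} (hU : IsOpen U) (hUc : IsPreconnected U)
    (heq : ∀ x ∈ U, lapl n f x = -lam * f x) {x : 𝔼} (hx : x ∈ U)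
    (hflat : ∀ e k, (dirDeriv e)^[k] f x = 0) : ∀ y ∈ U, f y = 0 := by
  have hsub : U ⊆ {y | f =ᶠ[𝓝 y] 0} := by
    refine hUc.subset_of_closure_inter_subset (isOpen_iff_mem_nhds.2 fun y hy => ?_)
      ⟨x, hx, eventuallyEq_zero_of_flat hlam hf hU heq hx hflat⟩ fun y hy => ?_
    · exact Filter.Eventually.eventually_nhds hy
    · refine eventuallyEq_zero_of_flat hlam hf hU heq hy.2 fun e k => ?_
      have hcl : IsClosed {z | (dirDeriv e)^[k] f z = 0} :=
        isClosed_eq (contDiff_dirDeriv_iterate hf e k).continuous continuous_const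
      exact closure_minimal (fun z hz => (dirDeriv_iterate_eventuallyEq_zero hz e k).eq_of_nhds)
        hcl hy.1
  exact fun y hy => (hsub hy).eq_of_nhds

lemma isPolyFun_multilinear_diag {d : ℕ} (T : ContinuousMultilinearMap ℝ (fun _ : Fin d => 𝔼) ℝ)
    (c : ℝ) : IsPolyFun n fun x => c * T fun _ => x := by
  refine ⟨MvPolynomial.C c * ∑ l : Fin d → Fin n, (∏ i, MvPolynomial.X (l i)) *
    MvPolynomial.C (T fun i => EuclideanSpace.single (l i) 1), fun x => ?_⟩
  have hx : x = ∑ j, x j • (EuclideanSpace.single j (1 : ℝ) : 𝔼) := by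
    ext i
    simp [Pi.single_apply]
  have h : (T fun _ => x) = ∑ l : Fin d → Fin n, T fun i =>
      x (l i) • (EuclideanSpace.single (l i) (1 : ℝ) : 𝔼) := by
    rw [← T.map_sum (fun _ j => x j • (EuclideanSpace.single j (1 : ℝ) : 𝔼)), ← hx]
  simp only [map_mul, map_sum, map_prod, MvPolynomial.eval_C, MvPolynomial.eval_X]
  rw [h]
  congr 1
  refine Finset.sum_congr rfl fun l _ => ?_
  rw [T.map_smul_univ, smul_eq_mul]

lemma dirDeriv_const_mul (c : ℝ) (f : 𝔼 → ℝ) (e : 𝔼) :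
    dirDeriv e (fun x => c * f x) = fun x => c * dirDeriv e f x := by
  ext x
  change fderiv ℝ (c • f) x e = c * fderiv ℝ f x e
  rw [fderiv_const_smul_field]
  rfl

lemma lapl_iteratedFDeriv_diag {f : 𝔼 → ℝ} (hf : ContDiff ℝ (⊤ : ℕ∞) f) (d : ℕ) (y x : 𝔼) (c : ℝ) :
    lapl n (fun x => c * iteratedFDeriv ℝ d f y fun _ => x) x =
      c * (d * ((d - 1 : ℕ) * lapl n ((dirDeriv x)^[d - 2] f) y)) := by
  simp only [lapl_eq_sum_dirDeriv, Finset.mul_sum]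
  refine Finset.sum_congr rfl fun j _ => ?_
  set e : 𝔼 := EuclideanSpace.single j 1
  have hs := contDiff_dirDeriv hf e
  rw [dirDeriv_const_mul, dirDeriv_const_mul, dirDeriv_iteratedFDeriv_diag hf,
    dirDeriv_const_mul, dirDeriv_iteratedFDeriv_diag hs]
  beta_reduce
  rw [iteratedFDeriv_const_eq (contDiff_dirDeriv hs e), dirDeriv_iterate_comm hs,
    dirDeriv_iterate_comm hf]
  rfl

lemma exists_abs_sub_iteratedFDeriv_le {f : 𝔼 → ℝ} (hf : ContDiff ℝ (⊤ : ℕ∞) f) (d : ℕ)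
    (hlow : ∀ k < d, ∀ e, (dirDeriv e)^[k] f 0 = 0) :
    ∃ C, ∀ᶠ x in 𝓝 (0 : 𝔼),
      |f x - (d.factorial : ℝ)⁻¹ * iteratedFDeriv ℝ d f 0 fun _ => x| ≤ C * ‖x‖ ^ (d + 1) := by
  have hcont : Continuous (iteratedFDeriv ℝ (d + 1) f) :=
    hf.continuous_iteratedFDeriv (by exact_mod_cast le_top)
  set K := ‖iteratedFDeriv ℝ (d + 1) f 0‖ + 1
  have hK : ∀ᶠ z in 𝓝 (0 : 𝔼), ‖iteratedFDeriv ℝ (d + 1) f z‖ < K :=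
    hcont.norm.continuousAt.eventually_lt_const (lt_add_one _)
  obtain ⟨r, hr, hrK⟩ := Metric.eventually_nhds_iff_ball.1 hK
  refine ⟨K / d.factorial, ?_⟩
  filter_upwards [ball_mem_nhds 0 hr] with x hx
  have h := abs_sub_taylor_le hf d 0 x (C := K * ‖x‖ ^ (d + 1)) fun t ht => by
    rw [← iteratedFDeriv_const_eq hf]
    refine ((iteratedFDeriv ℝ (d + 1) f _).le_opNorm _).trans ?_
    simp only [Finset.prod_const, Finset.card_univ, Fintype.card_fin]
    refine mul_le_mul_of_nonneg_right (hrK _ ?_).le (by positivity)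
    rw [mem_ball_zero_iff] at hx ⊢
    rw [zero_add, norm_smul, Real.norm_of_nonneg ht.1]
    exact (mul_le_of_le_one_left (norm_nonneg _) ht.2).trans_lt hx
  rw [Finset.sum_range_succ, Finset.sum_eq_zero fun j hj => by
    rw [hlow j (Finset.mem_range.1 hj), mul_zero], zero_add, zero_add,
    ← iteratedFDeriv_const_eq hf] at h
  exact h.trans_eq (by ring)

end EuclideanSpace

/-- Bers-type approximation of an eigenfunction near a zero by a homogeneous
harmonic polynomial. -/
theorem stmt_9 (n : ℕ) (lam : ℝ) (hlam : 0 ≤ lam)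
    (U : Set (EuclideanSpace ℝ (Fin n))) (hUopen : IsOpen U) (hUconn : IsConnected U)
    (hU0 : (0 : EuclideanSpace ℝ (Fin n)) ∈ U)
    (u : EuclideanSpace ℝ (Fin n) → ℝ) (hu : ContDiff ℝ (⊤ : ℕ∞) u)
    (heq : ∀ x ∈ U, lapl n u x = -lam * u x)
    (hne : ∃ x ∈ U, u x ≠ 0) :
    ∃ (d : ℕ) (P : EuclideanSpace ℝ (Fin n) → ℝ),
      IsPolyFun n P ∧
      (∃ x, P x ≠ 0) ∧
      (∀ t : ℝ, 0 < t → ∀ x, P (t • x) = t ^ d * P x) ∧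
      ContDiff ℝ 2 P ∧ (∀ x, lapl n P x = 0) ∧
      Tendsto (fun x : EuclideanSpace ℝ (Fin n) => (u x - P x) / ‖x‖ ^ d)
        (𝓝[≠] (0 : EuclideanSpace ℝ (Fin n))) (𝓝 0) := by
  classical
  have hex : ∃ d, ∃ e, (dirDeriv e)^[d] u 0 ≠ 0 := by
    by_contra! hflat
    obtain ⟨x, hx, hux⟩ := hne
    exact hux (eqOn_zero_of_flat hlam hu hUopen hUconn.isPreconnected heq hU0
      (fun e k => hflat k e) x hx)
  obtain ⟨e, he⟩ := Nat.find_spec hex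
  set d := Nat.find hex
  have hlow : ∀ k < d, ∀ e, (dirDeriv e)^[k] u 0 = 0 := by
    intro k hk
    simpa using Nat.find_min hex hk
  set T := iteratedFDeriv ℝ d u 0
  refine ⟨d, fun x => (d.factorial : ℝ)⁻¹ * T fun _ => x, isPolyFun_multilinear_diag T _,
    ⟨e, ?_⟩, fun t _ x => ?_, ?_, fun x => ?_, ?_⟩
  · exact mul_ne_zero (by positivity) (by rwa [iteratedFDeriv_const_eq hu])
  · have h := T.map_smul_univ (fun _ => t) fun _ => x
    simp only [Finset.prod_const, Finset.card_univ, Fintype.card_fin, smul_eq_mul] at h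
    change _ * (T fun _ => t • x) = _
    rw [h]
    ring
  · exact contDiff_const.mul (T.contDiff.comp (contDiff_pi.2 fun _ => contDiff_id))
  · rw [lapl_iteratedFDeriv_diag hu, lapl_dirDeriv_iterate hu hUopen heq x _ 0 hU0]
    rcases Nat.eq_zero_or_pos d with hd | hd
    · simp [hd]
    · simp [hlow (d - 2) (by lia)]
  · obtain ⟨C, hC⟩ := exists_abs_sub_iteratedFDeriv_le hu d hlow
    have hlim : Tendsto (fun x : EuclideanSpace ℝ (Fin n) => C * ‖x‖) (𝓝[≠] 0) (𝓝 0) := by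
      have : Continuous fun x : EuclideanSpace ℝ (Fin n) => C * ‖x‖ := by fun_prop
      simpa using (this.tendsto 0).mono_left nhdsWithin_le_nhds
    refine squeeze_zero_norm' ?_ hlim
    filter_upwards [nhdsWithin_le_nhds hC, self_mem_nhdsWithin] with x hx hx0
    have hpos : 0 < ‖x‖ ^ d := pow_pos (norm_pos_iff.2 hx0) d
    rw [norm_div, Real.norm_eq_abs, Real.norm_of_nonneg hpos.le, div_le_iff₀ hpos]
    exact hx.trans_eq (by ring)
end
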